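/- arXiv:2007.12366 — 6 statements merged into one kernel-verified Lean document; each statement's English description precedes it below -/
import Mathlib

section
/- Let K ≥ 1 and let F : [0,1]^K → [0,∞) be an increasing Borel combining function that is homogeneous, i.e. F(λp) = λF(p) for all λ ∈ (0,1] and p ∈ [0,1]^K. Then the VAD threshold of F is linear: there exists a constant c ≥ 0 such that a_F(ε) = c·ε for all ε ∈ (0,1). -/
open MeasureTheory ProbabilityTheory Real Set Filter

/-- The uniform probability measure on `[0,1]` (Lebesgue measure restricted to `[0,1]`). -/
noncomputable def unif01 : MeasureTheory.Measure ℝ :=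
  MeasureTheory.volume.restrict (Set.Icc (0:ℝ) 1)

instance : MeasureTheory.IsProbabilityMeasure unif01 := by
  constructor
  simp [unif01, Real.volume_Icc]

/-- `U` is uniformly distributed on `[0,1]` under `P`. -/
def IsUnif {Ω : Type*} [MeasurableSpace Ω] (P : MeasureTheory.Measure Ω) (U : Ω → ℝ) : Prop :=
  Measurable U ∧ MeasureTheory.Measure.map U P = unif01

/-- Left `ε`-quantile of a random variable `X` under `P`:
`q_ε(X) = inf {x : ε ≤ P(X ≤ x)}`. -/
noncomputable def lQuantile {Ω : Type*} [MeasurableSpace Ω] (P : MeasureTheory.Measure Ω)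
    (X : Ω → ℝ) (ε : ℝ) : ℝ :=
  sInf {x : ℝ | ε ≤ (P {ω | X ω ≤ x}).toReal}

/-- The measure `P` is atomless: every non-null measurable set has a measurable subset of
different, nonzero measure. -/
def Atomless {Ω : Type*} [MeasurableSpace Ω] (P : MeasureTheory.Measure Ω) : Prop :=
  ∀ A, MeasurableSet A → P A ≠ 0 →
    ∃ B, B ⊆ A ∧ MeasurableSet B ∧ P B ≠ 0 ∧ P B ≠ P A

/-- VAD threshold: infimum of left `ε`-quantiles of `F(U_1,…,U_K)` over all
uniformly distributed `U_1,…,U_K` on `[0,1]` with arbitrary joint dependence. -/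
noncomputable def VAD {Ω : Type*} [MeasurableSpace Ω] (P : MeasureTheory.Measure Ω) (K : ℕ)
    (F : (Fin K → ℝ) → ℝ) (ε : ℝ) : ℝ :=
  sInf {y : ℝ | ∃ U : Fin K → Ω → ℝ, (∀ i, IsUnif P (U i)) ∧
    y = lQuantile P (fun ω => F (fun i => U i ω)) ε}

/-- VI threshold: left `ε`-quantile of `F(V_1,…,V_K)` for independent uniforms,
realized via the product measure. -/
noncomputable def VI (K : ℕ) (F : (Fin K → ℝ) → ℝ) (ε : ℝ) : ℝ :=
  lQuantile (MeasureTheory.Measure.pi fun _ : Fin K => unif01) F ε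

/-- VC threshold: left `ε`-quantile of `F(U,…,U)` for a single uniform `U`. -/
noncomputable def VC (K : ℕ) (F : (Fin K → ℝ) → ℝ) (ε : ℝ) : ℝ :=
  lQuantile unif01 (fun u => F (fun _ => u)) ε

lemma unif01_Iic_of_mem {t : ℝ} (ht : t ∈ Set.Icc (0:ℝ) 1) :
    unif01 (Set.Iic t) = ENNReal.ofReal t := by
  have h : Set.Iic t ∩ Set.Icc (0:ℝ) 1 = Set.Icc 0 t := by
    ext x
    simp only [Set.mem_inter_iff, Set.mem_Iic, Set.mem_Icc]
    constructor
    · rintro ⟨h1, h2, _⟩; exact ⟨h2, h1⟩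
    · rintro ⟨h1, h2⟩; exact ⟨h2, h1, h2.trans ht.2⟩
  rw [unif01, Measure.restrict_apply measurableSet_Iic, h, Real.volume_Icc, sub_zero]

lemma unif01_Icc : unif01 (Set.Icc (0:ℝ) 1) = 1 := by
  simp [unif01, Real.volume_Icc]

lemma ae_unif01_mem : ∀ᵐ x ∂unif01, x ∈ Set.Icc (0:ℝ) 1 :=
  ae_restrict_mem measurableSet_Icc

lemma continuous_cdf_of_null_singleton (κ : Measure ℝ) [IsProbabilityMeasure κ]
    (h : ∀ x, κ {x} = 0) : Continuous (cdf κ) := by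
  rw [continuous_iff_continuousAt]
  intro x
  have h1 : (cdf κ).measure {x} = 0 := by rw [measure_cdf]; exact h x
  rw [StieltjesFunction.measure_singleton, ENNReal.ofReal_eq_zero, sub_nonpos] at h1
  rw [(cdf κ).mono.continuousAt_iff_leftLim_eq_rightLim, StieltjesFunction.rightLim_eq]
  exact le_antisymm ((cdf κ).mono.leftLim_le le_rfl) h1

/-- Probability integral transform: a law without atoms is sent to the uniform law by its
distribution function. -/
lemma map_cdf_eq_unif01 (κ : Measure ℝ) [IsProbabilityMeasure κ] (h : ∀ x, κ {x} = 0) :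
    κ.map (cdf κ) = unif01 := by
  have hc := continuous_cdf_of_null_singleton κ h
  have hm : Measurable (cdf κ) := hc.measurable
  have hex : ∀ t ∈ Set.Ioo (0:ℝ) 1, ∃ x, cdf κ x = t := fun t ht =>
    mem_range_of_exists_le_of_exists_ge hc
      (((tendsto_cdf_atBot κ).eventually (gt_mem_nhds ht.1)).exists.imp fun _ h => h.le)
      (((tendsto_cdf_atTop κ).eventually (lt_mem_nhds ht.2)).exists.imp fun _ h => h.le)
  have hlt : ∀ t ∈ Set.Ioo (0:ℝ) 1, κ {x | cdf κ x < t} ≤ ENNReal.ofReal t := by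
    intro t ht
    obtain ⟨x, hx⟩ := hex t ht
    rw [← hx, ofReal_cdf]
    exact measure_mono fun z hz => ((monotone_cdf κ).reflect_lt hz).le
  have hge : ∀ t ∈ Set.Ioo (0:ℝ) 1, ENNReal.ofReal t ≤ κ {x | cdf κ x ≤ t} := by
    intro t ht
    obtain ⟨x, hx⟩ := hex t ht
    rw [← hx, ofReal_cdf]
    exact measure_mono fun z hz => monotone_cdf κ hz
  have : IsProbabilityMeasure (κ.map (cdf κ)) := Measure.isProbabilityMeasure_map hm.aemeasurable
  refine Measure.ext_of_Iic _ _ fun t => ?_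
  rw [Measure.map_apply hm measurableSet_Iic]
  change κ {x | cdf κ x ≤ t} = _
  rcases lt_or_ge t 0 with h0 | h0
  · have e1 : {x | cdf κ x ≤ t} = ∅ := by
      ext x
      simpa using h0.trans_le (cdf_nonneg κ x)
    have e2 : Set.Iic t ∩ Set.Icc (0:ℝ) 1 = ∅ := by
      ext x
      simp only [Set.mem_inter_iff, Set.mem_Iic, Set.mem_Icc, Set.mem_empty_iff_false, iff_false]
      rintro ⟨h1, h2, _⟩
      linarith
    rw [e1, unif01, Measure.restrict_apply measurableSet_Iic, e2]
    simp
  rcases lt_or_ge t 1 with h1 | h1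
  · rw [unif01_Iic_of_mem ⟨h0, h1.le⟩]
    apply le_antisymm
    · have hlim : Tendsto (fun s : ℝ => ENNReal.ofReal s) (nhdsWithin t (Set.Ioi t))
          (nhds (ENNReal.ofReal t)) :=
        (ENNReal.continuous_ofReal.tendsto t).mono_left nhdsWithin_le_nhds
      refine ge_of_tendsto hlim ?_
      filter_upwards [Ioo_mem_nhdsGT h1] with s hs
      exact (measure_mono fun z hz => lt_of_le_of_lt hz hs.1).trans
        (hlt s ⟨h0.trans_lt hs.1, hs.2⟩)
    · rcases h0.eq_or_lt with h0 | h0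
      · simp [← h0]
      · exact hge t ⟨h0, h1⟩
  · have e1 : {x | cdf κ x ≤ t} = Set.univ := by
      ext x
      simpa using (cdf_le_one κ x).trans h1
    rw [e1, measure_univ]
    refine le_antisymm ?_ prob_le_one
    rw [← unif01_Icc]
    exact measure_mono fun x hx => hx.2.trans h1

lemma smul_map_affine_unif01 {a : ℝ} (ha : 0 < a) (b : ℝ) :
    ENNReal.ofReal a • unif01.map (fun x => a * x + b) =
      (volume : Measure ℝ).restrict (Set.Icc b (a + b)) := by
  ext s hs
  have hm : Measurable fun x : ℝ => a * x + b := by fun_prop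
  have e : (fun x : ℝ => a * x + b) ⁻¹' s ∩ Set.Icc 0 1 =
      (fun x => a * x) ⁻¹' ((fun x => x + b) ⁻¹' (s ∩ Set.Icc b (a + b))) := by
    ext x
    simp only [Set.mem_inter_iff, Set.mem_preimage, Set.mem_Icc]
    refine and_congr_right fun _ => and_congr ?_ ?_
    · rw [le_add_iff_nonneg_left]
      exact (mul_nonneg_iff_of_pos_left ha).symm
    · rw [add_le_add_iff_right]
      exact (mul_le_iff_le_one_right ha).symm
  rw [Measure.smul_apply, Measure.map_apply hm hs, unif01, Measure.restrict_apply (hm hs),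
    Measure.restrict_apply hs, e, Real.volume_preimage_mul_left ha.ne', measure_preimage_add_right,
    smul_eq_mul, ← mul_assoc, abs_of_pos (inv_pos.2 ha), ← ENNReal.ofReal_mul ha.le,
    mul_inv_cancel₀ ha.ne', ENNReal.ofReal_one, one_mul]

lemma unif01_mixture {ε : ℝ} (hε : ε ∈ Set.Ioo (0:ℝ) 1) :
    ENNReal.ofReal ε • unif01.map (fun x => ε * x) +
      ENNReal.ofReal (1 - ε) • unif01.map (fun x => (1 - ε) * x + ε) = unif01 := by
  have h1 := smul_map_affine_unif01 hε.1 0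
  simp only [add_zero] at h1
  rw [h1, smul_map_affine_unif01 (sub_pos.2 hε.2), sub_add_cancel, unif01,
    ← Measure.restrict_congr_set (Ioc_ae_eq_Icc (a := ε) (b := 1)),
    ← Measure.restrict_union _ measurableSet_Ioc, Set.Icc_union_Ioc_eq_Icc hε.1.le hε.2.le]
  exact Set.disjoint_left.2 fun x hx hx' => absurd hx.2 (not_le.2 hx'.1)

/-- `μ` is the law of a random vector with uniform marginals. -/
def IsUnifCoupling {K : ℕ} (μ : Measure (Fin K → ℝ)) : Prop :=
  ∀ i, μ.map (fun p => p i) = unif01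

lemma IsUnifCoupling.ae_mem {K : ℕ} {μ : Measure (Fin K → ℝ)} (h : IsUnifCoupling μ) :
    ∀ᵐ p ∂μ, ∀ i, p i ∈ Set.Icc (0:ℝ) 1 := by
  rw [ae_all_iff]
  intro i
  have := ae_unif01_mem
  rw [← h i] at this
  exact ae_of_ae_map (measurable_pi_apply i).aemeasurable this

/-- The levels `y` which `F` stays below with probability at least `ε` under some coupling of
uniform laws. -/
def couplingLevels {K : ℕ} (F : (Fin K → ℝ) → ℝ) (ε : ℝ) : Set ℝ :=
  {y | ∃ μ : Measure (Fin K → ℝ), IsProbabilityMeasure μ ∧ IsUnifCoupling μ ∧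
    ENNReal.ofReal ε ≤ μ {p | F p ≤ y}}

section Levels

variable {K : ℕ} {F : (Fin K → ℝ) → ℝ}

lemma nonneg_of_mem_couplingLevels
    (hFnonneg : ∀ p : Fin K → ℝ, (∀ i, p i ∈ Set.Icc (0:ℝ) 1) → 0 ≤ F p)
    {ε : ℝ} (hε : 0 < ε) {y : ℝ} (hy : y ∈ couplingLevels F ε) : 0 ≤ y := by
  obtain ⟨μ, _, hμ, hle⟩ := hy
  have hpos : μ {p | F p ≤ y} ≠ 0 := ((ENNReal.ofReal_pos.2 hε).trans_le hle).ne'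
  obtain ⟨p, hp, hcube⟩ :=
    (((frequently_ae_iff (p := fun p => F p ≤ y)).2 hpos).and_eventually hμ.ae_mem).exists
  exact (hFnonneg p hcube).trans hp

lemma mul_mem_couplingLevels (hFmeas : Measurable F)
    (hFhom : ∀ lam ∈ Set.Ioc (0:ℝ) 1, ∀ p : Fin K → ℝ,
      (∀ i, p i ∈ Set.Icc (0:ℝ) 1) → F (fun i => lam * p i) = lam * F p)
    {ε : ℝ} (hε : ε ∈ Set.Ioo (0:ℝ) 1) {m : ℝ} (hm : m ∈ couplingLevels F 1) :
    ε * m ∈ couplingLevels F ε := by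
  obtain ⟨μ, hμp, hμ, hle⟩ := hm
  have m1 : Measurable fun (p : Fin K → ℝ) i => ε * p i := by fun_prop
  have m2 : Measurable fun (u : ℝ) (_ : Fin K) => (1 - ε) * u + ε := by fun_prop
  have hS : MeasurableSet {p | F p ≤ ε * m} := measurableSet_le hFmeas measurable_const
  refine ⟨ENNReal.ofReal ε • μ.map (fun p i => ε * p i) +
    ENNReal.ofReal (1 - ε) • unif01.map (fun u _ => (1 - ε) * u + ε), ⟨?_⟩, fun i => ?_, ?_⟩
  · rw [Measure.add_apply, Measure.smul_apply, Measure.smul_apply,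
      Measure.map_apply m1 MeasurableSet.univ, Measure.map_apply m2 MeasurableSet.univ,
      Set.preimage_univ, Set.preimage_univ, measure_univ, measure_univ, smul_eq_mul, smul_eq_mul,
      mul_one, mul_one, ← ENNReal.ofReal_add hε.1.le (sub_nonneg.2 hε.2.le)]
    simp
  · have hi : Measurable fun p : Fin K → ℝ => p i := measurable_pi_apply i
    have e : (μ.map fun p i => ε * p i).map (fun p => p i) = unif01.map (fun x => ε * x) := by
      rw [Measure.map_map hi m1, ← hμ i, Measure.map_map (by fun_prop) hi]
      rfl
    rw [Measure.map_add _ _ hi, Measure.map_smul, Measure.map_smul, e, Measure.map_map hi m2]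
    exact unif01_mixture hε
  · rw [Measure.add_apply, Measure.smul_apply, Measure.map_apply m1 hS, smul_eq_mul]
    refine le_add_right ?_
    have : 1 ≤ μ ((fun (p : Fin K → ℝ) i => ε * p i) ⁻¹' {p | F p ≤ ε * m}) := by
      rw [ENNReal.ofReal_one] at hle
      refine hle.trans (measure_mono_ae ?_)
      filter_upwards [hμ.ae_mem] with p hp hFp
      change F (fun i => ε * p i) ≤ ε * m
      rw [hFhom ε ⟨hε.1, hε.2.le⟩ p hp]
      exact mul_le_mul_of_nonneg_left hFp hε.1.le
    calc ENNReal.ofReal ε = ENNReal.ofReal ε * 1 := (mul_one _).symm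
      _ ≤ _ := by gcongr

lemma div_mem_couplingLevels (hFmeas : Measurable F)
    (hFmono : ∀ p q : Fin K → ℝ, (∀ i, p i ∈ Set.Icc (0:ℝ) 1) →
      (∀ i, q i ∈ Set.Icc (0:ℝ) 1) → p ≤ q → F p ≤ F q)
    (hFhom : ∀ lam ∈ Set.Ioc (0:ℝ) 1, ∀ p : Fin K → ℝ,
      (∀ i, p i ∈ Set.Icc (0:ℝ) 1) → F (fun i => lam * p i) = lam * F p)
    {ε : ℝ} (hε : ε ∈ Set.Ioo (0:ℝ) 1) {y : ℝ} (hy : y ∈ couplingLevels F ε) :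
    y / ε ∈ couplingLevels F 1 := by
  obtain ⟨μ, hμp, hμ, hle⟩ := hy
  set A : Set (Fin K → ℝ) := {p | F p ≤ y} with hA
  have hAm : MeasurableSet A := measurableSet_le hFmeas measurable_const
  have hε0 : ENNReal.ofReal ε ≠ 0 := (ENNReal.ofReal_pos.2 hε.1).ne'
  have hA0 : μ A ≠ 0 := ((ENNReal.ofReal_pos.2 hε.1).trans_le hle).ne'
  have : IsProbabilityMeasure (μ[|A]) := cond_isProbabilityMeasure hA0
  have hi : ∀ i, Measurable fun p : Fin K → ℝ => p i := fun i => measurable_pi_apply i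
  let κ : Fin K → Measure ℝ := fun i => (μ[|A]).map (fun p => p i)
  have hκp : ∀ i, IsProbabilityMeasure (κ i) := fun i =>
    Measure.isProbabilityMeasure_map (hi i).aemeasurable
  have hκ : ∀ i s, MeasurableSet s → ENNReal.ofReal ε * κ i s ≤ unif01 s := by
    intro i s hs
    rw [Measure.map_apply (hi i) hs, cond_apply hAm, ← hμ i, Measure.map_apply (hi i) hs]
    calc ENNReal.ofReal ε * ((μ A)⁻¹ * μ (A ∩ (fun p => p i) ⁻¹' s))
        ≤ μ A * ((μ A)⁻¹ * μ ((fun p => p i) ⁻¹' s)) := by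
          gcongr
          exact Set.inter_subset_right
      _ = μ ((fun p => p i) ⁻¹' s) := by
          rw [← mul_assoc, ENNReal.mul_inv_cancel hA0 (measure_ne_top _ _), one_mul]
  have hκ0 : ∀ i x, κ i {x} = 0 := by
    intro i x
    have h := hκ i {x} (measurableSet_singleton x)
    have h0 : unif01 {x} = 0 := by simp [unif01]
    rw [h0, nonpos_iff_eq_zero, mul_eq_zero] at h
    exact h.resolve_left hε0
  have hcdf : ∀ i, ∀ x ∈ Set.Icc (0:ℝ) 1, ε * cdf (κ i) x ≤ x := by
    intro i x hx
    have h := hκ i (Set.Iic x) measurableSet_Iic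
    rw [← ofReal_cdf, unif01_Iic_of_mem hx, ← ENNReal.ofReal_mul hε.1.le] at h
    exact (ENNReal.ofReal_le_ofReal_iff hx.1).1 h
  have hcm : ∀ i, Measurable (cdf (κ i)) := fun i => (monotone_cdf (κ i)).measurable
  have hHm : Measurable fun (p : Fin K → ℝ) i => cdf (κ i) (p i) :=
    measurable_pi_lambda _ fun i => (hcm i).comp (hi i)
  refine ⟨(μ[|A]).map (fun p i => cdf (κ i) (p i)),
    Measure.isProbabilityMeasure_map hHm.aemeasurable, fun i => ?_, ?_⟩
  · rw [Measure.map_map (hi i) hHm, ← map_cdf_eq_unif01 (κ i) (hκ0 i),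
      Measure.map_map (hcm i) (hi i)]
    rfl
  · rw [ENNReal.ofReal_one, Measure.map_apply hHm (measurableSet_le hFmeas measurable_const),
      ← measure_univ (μ := μ[|A])]
    refine measure_mono_ae ?_
    have hcube := (cond_absolutelyContinuous (μ := μ) (s := A)).ae_le hμ.ae_mem
    filter_upwards [hcube, ae_cond_mem hAm] with p hp hpA _
    change F (fun i => cdf (κ i) (p i)) ≤ y / ε
    have hH : ∀ i, cdf (κ i) (p i) ∈ Set.Icc (0:ℝ) 1 := fun i =>
      ⟨cdf_nonneg _ _, cdf_le_one _ _⟩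
    rw [le_div_iff₀' hε.1, ← hFhom ε ⟨hε.1, hε.2.le⟩ _ hH]
    refine (hFmono _ p (fun i => ?_) hp fun i => hcdf i _ (hp i)).trans hpA
    exact ⟨mul_nonneg hε.1.le (hH i).1, mul_le_one₀ hε.2.le (hH i).1 (hH i).2⟩

end Levels

/-- On a space carrying a uniform variable, every Borel law on `ℝ^K` is the law of some vector. -/
lemma exists_map_eq_of_isUnif {Ω : Type*} [MeasurableSpace Ω] {P : Measure Ω} {U : Ω → ℝ}
    (hU : IsUnif P U) {K : ℕ} (μ : Measure (Fin K → ℝ)) [IsProbabilityMeasure μ] :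
    ∃ W : Ω → Fin K → ℝ, Measurable W ∧ P.map W = μ := by
  obtain ⟨f, hf, hfμ⟩ := μ.exists_measurable_map_eq
  have hproj : Measurable (Set.projIcc (0:ℝ) 1 zero_le_one) := continuous_projIcc.measurable
  have hval : (volume : Measure unitInterval).map Subtype.val = unif01 :=
    map_comap_subtype_coe measurableSet_Icc volume
  have hI : unif01.map (Set.projIcc (0:ℝ) 1 zero_le_one) = volume := by
    rw [← hval, Measure.map_map hproj measurable_subtype_coe]
    convert Measure.map_id using 2
    ext x
    simp
  refine ⟨fun ω => f (Set.projIcc (0:ℝ) 1 zero_le_one (U ω)), hf.comp (hproj.comp hU.1), ?_⟩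
  rw [← hfμ, ← hI, ← hU.2, Measure.map_map hproj hU.1, Measure.map_map hf (hproj.comp hU.1)]
  rfl

lemma VAD_eq_sInf_couplingLevels {Ω : Type*} [MeasurableSpace Ω] {P : Measure Ω}
    [IsProbabilityMeasure P] {U₀ : Ω → ℝ} (hU₀ : IsUnif P U₀) {K : ℕ} {F : (Fin K → ℝ) → ℝ}
    (hFmeas : Measurable F)
    (hFnonneg : ∀ p : Fin K → ℝ, (∀ i, p i ∈ Set.Icc (0:ℝ) 1) → 0 ≤ F p)
    (hFmono : ∀ p q : Fin K → ℝ, (∀ i, p i ∈ Set.Icc (0:ℝ) 1) →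
      (∀ i, q i ∈ Set.Icc (0:ℝ) 1) → p ≤ q → F p ≤ F q)
    {ε : ℝ} (hε : ε ∈ Set.Ioo (0:ℝ) 1) :
    VAD P K F ε = sInf (couplingLevels F ε) := by
  have hlaw : ∀ U : Fin K → Ω → ℝ, (∀ i, IsUnif P (U i)) →
      IsProbabilityMeasure (P.map fun ω i => U i ω) ∧ IsUnifCoupling (P.map fun ω i => U i ω) ∧
        ∀ x, P {ω | F (fun i => U i ω) ≤ x} = (P.map fun ω i => U i ω) {p | F p ≤ x} := by
    intro U hU
    have hm : Measurable fun ω i => U i ω := measurable_pi_lambda _ fun i => (hU i).1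
    refine ⟨Measure.isProbabilityMeasure_map hm.aemeasurable, fun i => ?_, fun x => ?_⟩
    · rw [Measure.map_map (measurable_pi_apply i) hm]
      exact (hU i).2
    · rw [Measure.map_apply hm (measurableSet_le hFmeas measurable_const)]
      rfl
  have hlevel : ∀ U : Fin K → Ω → ℝ, (∀ i, IsUnif P (U i)) →
      {x : ℝ | ε ≤ (P {ω | F (fun i => U i ω) ≤ x}).toReal} ⊆ couplingLevels F ε := by
    intro U hU x hx
    obtain ⟨h1, h2, h3⟩ := hlaw U hU
    refine ⟨_, h1, h2, ?_⟩
    rw [← h3]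
    exact (ENNReal.ofReal_le_iff_le_toReal (measure_ne_top _ _)).2 hx
  have hne : ∀ U : Fin K → Ω → ℝ, (∀ i, IsUnif P (U i)) →
      {x : ℝ | ε ≤ (P {ω | F (fun i => U i ω) ≤ x}).toReal}.Nonempty := by
    intro U hU
    obtain ⟨h1, h2, h3⟩ := hlaw U hU
    refine ⟨F fun _ => 1, ?_⟩
    have hone : (P.map fun ω i => U i ω) {p | F p ≤ F fun _ => 1} = 1 := by
      rw [← measure_univ (μ := P.map fun ω i => U i ω)]
      refine measure_congr (eventuallyEq_univ.2 ?_)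
      filter_upwards [h2.ae_mem] with p hp
      exact hFmono p _ hp (fun _ => by simp) fun i => (hp i).2
    change ε ≤ (P {ω | F (fun i => U i ω) ≤ F fun _ => 1}).toReal
    rw [h3, hone]
    simpa using hε.2.le
  have hnonneg := fun y => nonneg_of_mem_couplingLevels (y := y) hFnonneg hε.1
  have hbdd : BddBelow (couplingLevels F ε) := ⟨0, fun y hy => hnonneg y hy⟩
  apply le_antisymm
  · refine le_csInf ?_ fun y hy => ?_
    · exact (hne (fun _ => U₀) fun _ => hU₀).mono (hlevel _ fun _ => hU₀)
    · obtain ⟨μ, hμp, hμ, hle⟩ := hy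
      obtain ⟨W, hW, hWμ⟩ := exists_map_eq_of_isUnif hU₀ μ
      have hU : ∀ i, IsUnif P fun ω => W ω i := fun i => by
        refine ⟨(measurable_pi_apply i).comp hW, ?_⟩
        rw [← hμ i, ← hWμ, Measure.map_map (measurable_pi_apply i) hW]
        rfl
      have hq : lQuantile P (fun ω => F fun i => W ω i) ε ≤ y := by
        refine csInf_le (hbdd.mono (hlevel (fun i ω => W ω i) hU)) ?_
        change ε ≤ (P {ω | F (fun i => W ω i) ≤ y}).toReal
        rw [← ENNReal.ofReal_le_iff_le_toReal (measure_ne_top _ _)]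
        rwa [← hWμ, Measure.map_apply hW (measurableSet_le hFmeas measurable_const)] at hle
      refine (csInf_le ⟨0, ?_⟩ ?_).trans hq
      · rintro z ⟨U, hU, rfl⟩
        exact Real.sInf_nonneg fun x hx => hnonneg x (hlevel U hU hx)
      · exact ⟨fun i ω => W ω i, hU, rfl⟩
  · refine le_csInf ⟨_, fun _ => U₀, fun _ => hU₀, rfl⟩ ?_
    rintro z ⟨U, hU, rfl⟩
    exact csInf_le_csInf hbdd (hne U hU) (hlevel U hU)

/-- if the combining function `F` is homogeneous, then the VAD threshold
`a_F` is a linear function of `ε` on `(0,1)`. -/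
theorem vad_linear_of_homogeneous
    {Ω : Type*} [MeasurableSpace Ω] (P : MeasureTheory.Measure Ω)
    [MeasureTheory.IsProbabilityMeasure P] (hP : Atomless P)
    (K : ℕ) (hK : 1 ≤ K) (F : (Fin K → ℝ) → ℝ)
    (hFmeas : Measurable F)
    (hFnonneg : ∀ p : Fin K → ℝ, (∀ i, p i ∈ Set.Icc (0:ℝ) 1) → 0 ≤ F p)
    (hFmono : ∀ p q : Fin K → ℝ, (∀ i, p i ∈ Set.Icc (0:ℝ) 1) →
      (∀ i, q i ∈ Set.Icc (0:ℝ) 1) → p ≤ q → F p ≤ F q)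
    (hFhom : ∀ lam ∈ Set.Ioc (0:ℝ) 1, ∀ p : Fin K → ℝ,
      (∀ i, p i ∈ Set.Icc (0:ℝ) 1) → F (fun i => lam * p i) = lam * F p) :
    ∃ c : ℝ, 0 ≤ c ∧ ∀ ε ∈ Set.Ioo (0:ℝ) 1, VAD P K F ε = c * ε := by
  by_cases hex : ∃ U₀ : Ω → ℝ, IsUnif P U₀
  · obtain ⟨U₀, hU₀⟩ := hex
    refine ⟨sInf (couplingLevels F 1), Real.sInf_nonneg fun y hy =>
      nonneg_of_mem_couplingLevels hFnonneg one_pos hy, fun ε hε => ?_⟩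
    rw [VAD_eq_sInf_couplingLevels hU₀ hFmeas hFnonneg hFmono hε, mul_comm, ← smul_eq_mul,
      ← Real.sInf_smul_of_nonneg hε.1.le]
    congr 1
    ext y
    rw [Set.mem_smul_set]
    constructor
    · intro hy
      exact ⟨y / ε, div_mem_couplingLevels hFmeas hFmono hFhom hε hy,
        mul_div_cancel₀ y hε.1.ne'⟩
    · rintro ⟨m, hm, rfl⟩
      exact mul_mem_couplingLevels hFmeas hFhom hε hm
  · refine ⟨0, le_rfl, fun ε _ => ?_⟩
    have : {y : ℝ | ∃ U : Fin K → Ω → ℝ, (∀ i, IsUnif P (U i)) ∧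
        y = lQuantile P (fun ω => F (fun i => U i ω)) ε} = ∅ := by
      refine Set.eq_empty_of_forall_notMem ?_
      rintro y ⟨U, hU, -⟩
      exact hex ⟨U ⟨0, hK⟩, hU _⟩
    rw [VAD, this, Real.sInf_empty, zero_mul]
end

section
/- Let K ≥ 1 and F(p_1,…,p_K) = min{p_1,…,p_K} (the Bonferroni combining function). Then for every ε ∈ (0,1): a_F(ε) = ε/K, b_F(ε) = 1 − (1−ε)^{1/K}, and c_F(ε) = ε. -/
open MeasureTheory ProbabilityTheory Real Set Filter

/-- A maximal family of measurable sets that is strictly nested with strictly increasing measure. -/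
structure IsMaxNested {Ω : Type*} [MeasurableSpace Ω] (P : MeasureTheory.Measure Ω)
    (M : Set (Set Ω)) : Prop where
  measurable : ∀ A ∈ M, MeasurableSet A
  empty_mem : ∅ ∈ M
  univ_mem : Set.univ ∈ M
  subset : ∀ A ∈ M, ∀ B ∈ M, P.real A ≤ P.real B → A ⊆ B
  maximal : ∀ B, MeasurableSet B →
    ∃ A ∈ M, ¬(A ⊆ B ∧ P.real A < P.real B) ∧ ¬(B ⊆ A ∧ P.real B < P.real A)

section MaxNested

variable {Ω : Type*} [MeasurableSpace Ω] {P : MeasureTheory.Measure Ω} {M : Set (Set Ω)}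

theorem exists_isMaxNested (P : MeasureTheory.Measure Ω) [IsProbabilityMeasure P] :
    ∃ M, IsMaxNested P M := by
  let r : {A : Set Ω // MeasurableSet A} → {A : Set Ω // MeasurableSet A} → Prop :=
    fun A B => A.1 ⊆ B.1 ∧ P.real A.1 < P.real B.1
  have hc : IsChain r {⟨∅, MeasurableSet.empty⟩, ⟨Set.univ, MeasurableSet.univ⟩} := by
    refine IsChain.insert (by simp) ?_
    rintro b rfl -
    left
    simp [r]
  obtain ⟨N, hN, hcN⟩ := hc.exists_maxChain
  refine ⟨Subtype.val '' N, ?_, ?_, ?_, ?_, ?_⟩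
  · rintro _ ⟨A, -, rfl⟩
    exact A.2
  · exact ⟨_, hcN (Set.mem_insert _ _), rfl⟩
  · exact ⟨_, hcN (Set.mem_insert_of_mem _ rfl), rfl⟩
  · rintro _ ⟨A, hA, rfl⟩ _ ⟨B, hB, rfl⟩ hAB
    by_cases h : A = B
    · rw [h]
    · rcases hN.1 hA hB h with h | h
      · exact h.1
      · exact absurd h.2 hAB.not_gt
  · intro B hB
    by_contra! hcon
    have hchain : IsChain r (insert ⟨B, hB⟩ N) := by
      refine hN.1.insert fun A hA _ => ?_
      by_cases h : A.1 ⊆ B ∧ P.real A.1 < P.real B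
      · exact Or.inr h
      · exact Or.inl (hcon A.1 ⟨A, hA, rfl⟩ fun h1 => not_lt.1 fun h2 => h ⟨h1, h2⟩)
    have hmem : (⟨B, hB⟩ : {A : Set Ω // MeasurableSet A}) ∈ N := by
      rw [hN.2 hchain (Set.subset_insert _ _)]
      exact Set.mem_insert _ _
    exact lt_irrefl _ (hcon B ⟨_, hmem, rfl⟩ fun _ => le_rfl).2

theorem IsMaxNested.compl [IsProbabilityMeasure P] (h : IsMaxNested P M) :
    IsMaxNested P {A | Aᶜ ∈ M} where
  measurable A hA := (h.measurable _ hA).of_compl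
  empty_mem := by simpa using h.univ_mem
  univ_mem := by simpa using h.empty_mem
  subset A hA B hB hAB := by
    rw [← Set.compl_subset_compl]
    refine h.subset _ hB _ hA ?_
    rw [probReal_compl_eq_one_sub (h.measurable _ hA).of_compl,
      probReal_compl_eq_one_sub (h.measurable _ hB).of_compl]
    linarith
  maximal B hB := by
    obtain ⟨A, hA, h1, h2⟩ := h.maximal Bᶜ hB.compl
    rw [probReal_compl_eq_one_sub hB] at h1 h2
    refine ⟨Aᶜ, by simpa using hA, ?_, ?_⟩ <;> rw [probReal_compl_eq_one_sub (h.measurable _ hA)]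
    · rintro ⟨h3, h4⟩
      exact h2 ⟨Set.compl_subset_comm.1 h3, by linarith⟩
    · rintro ⟨h3, h4⟩
      exact h1 ⟨Set.subset_compl_comm.1 h3, by linarith⟩

theorem IsMaxNested.exists_greatest_le [IsProbabilityMeasure P] (h : IsMaxNested P M) {t : ℝ}
    (ht : 0 ≤ t) :
    ∃ A ∈ M, P.real A ≤ t ∧ ∀ B ∈ M, P.real B ≤ t → P.real B ≤ P.real A := by
  by_contra! hcon
  let S : Set ℝ := {s | ∃ A ∈ M, P.real A ≤ t ∧ P.real A = s}
  have hbdd : BddAbove S := ⟨t, by rintro _ ⟨A, -, hA, rfl⟩; exact hA⟩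
  have hne : S.Nonempty := ⟨_, ∅, h.empty_mem, by simpa using ht, rfl⟩
  obtain ⟨u, hu, hlim, hmem⟩ := exists_seq_tendsto_sSup hne hbdd
  choose C hCM hCt hCu using hmem
  have hmono : Monotone C := fun i j hij =>
    h.subset _ (hCM i) _ (hCM j) (by rw [hCu, hCu]; exact hu hij)
  have hP : P.real (⋃ n, C n) = sSup S := by
    refine tendsto_nhds_unique ?_ hlim
    have h1 := (ENNReal.tendsto_toReal (measure_ne_top P _)).comp
      (tendsto_measure_iUnion_atTop (μ := P) hmono)
    refine h1.congr fun n => ?_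
    simp [← hCu, Measure.real]
  have hle : sSup S ≤ t := csSup_le hne (by rintro _ ⟨A, -, hA, rfl⟩; exact hA)
  obtain ⟨A, hA, h1, h2⟩ := h.maximal (⋃ n, C n) (.iUnion fun n => h.measurable _ (hCM n))
  rw [hP] at h1 h2
  rcases le_or_gt (P.real A) t with hAt | hAt
  · obtain ⟨B, hB, hBt, hAB⟩ := hcon A hA hAt
    have hlt : P.real A < sSup S := hAB.trans_le (le_csSup hbdd ⟨B, hB, hBt, rfl⟩)
    obtain ⟨n, hn⟩ := (hlim.eventually (lt_mem_nhds hlt)).exists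
    refine h1 ⟨(h.subset _ hA _ (hCM n) ?_).trans (Set.subset_iUnion C n), hlt⟩
    rw [hCu]
    exact hn.le
  · exact h2 ⟨Set.iUnion_subset fun n => h.subset _ (hCM n) _ hA ((hCt n).trans hAt.le),
      hle.trans_lt hAt⟩

theorem IsMaxNested.exists_least_ge [IsProbabilityMeasure P] (h : IsMaxNested P M) {t : ℝ}
    (ht : t ≤ 1) :
    ∃ A ∈ M, t ≤ P.real A ∧ ∀ B ∈ M, t ≤ P.real B → P.real A ≤ P.real B := by
  obtain ⟨A, hA, hAt, hmax⟩ := h.compl.exists_greatest_le (t := 1 - t) (by linarith)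
  have hAm := h.compl.measurable A hA
  refine ⟨Aᶜ, hA, ?_, fun B hB hBt => ?_⟩
  · rw [probReal_compl_eq_one_sub hAm]
    linarith
  · have hBm := h.measurable B hB
    have := hmax Bᶜ (by simpa using hB) (by rw [probReal_compl_eq_one_sub hBm]; linarith)
    rw [probReal_compl_eq_one_sub hBm] at this
    rw [probReal_compl_eq_one_sub hAm]
    linarith

theorem IsMaxNested.exists_measure_eq [IsProbabilityMeasure P] (h : IsMaxNested P M)
    (hP : Atomless P) {t : ℝ} (ht0 : 0 ≤ t) (ht1 : t ≤ 1) : ∃ A ∈ M, P.real A = t := by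
  obtain ⟨A, hA, hAt, hAmax⟩ := h.exists_greatest_le ht0
  obtain ⟨B, hB, hBt, hBmin⟩ := h.exists_least_ge ht1
  by_contra! hcon
  have hAt' := lt_of_le_of_ne hAt (hcon A hA)
  have hBt' := lt_of_le_of_ne hBt (hcon B hB).symm
  have hAm := h.measurable A hA
  have hBm := h.measurable B hB
  have hAB := h.subset _ hA _ hB (hAt.trans hBt)
  have hdiff : P.real (B \ A) = P.real B - P.real A := measureReal_sdiff hAB hAm
  obtain ⟨D, hD, hDm, hD0, hDne⟩ := hP (B \ A) (hBm.diff hAm) (fun h0 => by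
    simp only [Measure.real, h0, ENNReal.toReal_zero] at hdiff
    simp only [Measure.real] at *
    linarith)
  have hD0' : 0 < P.real D := ENNReal.toReal_pos hD0 (measure_ne_top _ _)
  have hDlt : P.real D < P.real (B \ A) :=
    (ENNReal.toReal_lt_toReal (measure_ne_top _ _) (measure_ne_top _ _)).2
      (lt_of_le_of_ne (measure_mono hD) hDne)
  have hU : P.real (A ∪ D) = P.real A + P.real D :=
    measureReal_union (Set.disjoint_sdiff_right.mono_right hD) hDm
  obtain ⟨C, hC, h1, h2⟩ := h.maximal (A ∪ D) (hAm.union hDm)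
  rcases le_total (P.real C) t with hCt | hCt
  · have := hAmax C hC hCt
    exact h1 ⟨(h.subset _ hC _ hA this).trans Set.subset_union_left, by linarith⟩
  · have := hBmin C hC hCt
    exact h2 ⟨(Set.union_subset hAB (hD.trans Set.sdiff_subset)).trans (h.subset _ hB _ hC this),
      by linarith⟩

end MaxNested

theorem unif01_real_Iic (x : ℝ) : unif01.real (Set.Iic x) = max 0 (min x 1) := by
  have : Set.Iic x ∩ Set.Icc 0 1 = Set.Icc 0 (min x 1) := by
    ext y
    simp only [Set.mem_inter_iff, Set.mem_Iic, Set.mem_Icc, le_min_iff]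
    tauto
  rw [unif01, measureReal_restrict_apply measurableSet_Iic, this, Real.volume_real_Icc, sub_zero,
    max_comm]

theorem unif01_real_Iio (x : ℝ) : unif01.real (Set.Iio x) = max 0 (min x 1) := by
  rw [← unif01_real_Iic, unif01]
  exact measureReal_congr Iio_ae_eq_Iic

theorem unif01_real_Ioi (x : ℝ) : unif01.real (Set.Ioi x) = 1 - max 0 (min x 1) := by
  rw [← unif01_real_Iic, ← Set.compl_Iic, probReal_compl_eq_one_sub measurableSet_Iic]

/-- An atomless probability space carries a uniform random variable. -/
theorem Atomless.exists_isUnif {Ω : Type*} [MeasurableSpace Ω] {P : MeasureTheory.Measure Ω}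
    [IsProbabilityMeasure P] (hP : Atomless P) : ∃ U : Ω → ℝ, IsUnif P U := by
  obtain ⟨M, hM⟩ := exists_isMaxNested P
  have hex : ∀ t : ℝ, ∃ A ∈ M, P.real A = max 0 (min t 1) := fun t =>
    hM.exists_measure_eq hP (le_max_left _ _) (max_le zero_le_one (min_le_right _ _))
  choose A hAM hAP using hex
  have hAm t : MeasurableSet (A t) := hM.measurable _ (hAM t)
  have hmono : Monotone A := fun s t hst => hM.subset _ (hAM s) _ (hAM t) (by
    rw [hAP, hAP]
    gcongr)
  have hA1 : A 1 = Set.univ :=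
    (Set.univ_subset_iff).1 (hM.subset _ hM.univ_mem _ (hAM 1) (by simp [hAP]))
  let U : Ω → ℝ := fun ω => sInf {t | 0 ≤ t ∧ ω ∈ A t}
  have hUlt (x : ℝ) : {ω | U ω < x} = ⋃ q ∈ {q : ℚ | 0 ≤ q ∧ (q : ℝ) < x}, A q := by
    ext ω
    simp only [Set.mem_ofPred_eq, Set.mem_iUnion, exists_prop]
    constructor
    · intro hlt
      obtain ⟨t, ⟨ht0, htA⟩, htx⟩ :=
        exists_lt_of_csInf_lt (s := {t | 0 ≤ t ∧ ω ∈ A t}) ⟨1, zero_le_one, by simp [hA1]⟩ hlt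
      obtain ⟨q, htq, hqx⟩ := exists_rat_btwn htx
      exact ⟨q, ⟨by exact_mod_cast ht0.trans htq.le, hqx⟩, hmono htq.le htA⟩
    · rintro ⟨q, ⟨hq0, hqx⟩, hqA⟩
      exact (csInf_le (s := {t | 0 ≤ t ∧ ω ∈ A t}) ⟨0, fun t ht => ht.1⟩ ⟨by exact_mod_cast hq0, hqA⟩).trans_lt hqx
  have hUm : Measurable U := measurable_of_Iio fun x => by
    rw [show U ⁻¹' Set.Iio x = {ω | U ω < x} from rfl, hUlt]
    exact .biUnion (Set.to_countable _) fun q _ => hAm q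
  refine ⟨U, hUm, ?_⟩
  have : IsProbabilityMeasure (P.map U) := Measure.isProbabilityMeasure_map hUm.aemeasurable
  have hcdf (x : ℝ) : (P.map U).real (Set.Iio x) = unif01.real (Set.Iio x) := by
    rw [map_measureReal_apply hUm measurableSet_Iio, unif01_real_Iio]
    have hsub : U ⁻¹' Set.Iio x ⊆ A x := by
      rw [show U ⁻¹' Set.Iio x = {ω | U ω < x} from rfl, hUlt]
      exact Set.iUnion₂_subset fun q hq => hmono hq.2.le
    refine le_antisymm ((measureReal_mono hsub).trans_eq (hAP x)) ?_
    refine max_le measureReal_nonneg (le_of_forall_lt fun y hy => ?_)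
    rcases lt_or_ge y 0 with hy0 | hy0
    · exact hy0.trans_le measureReal_nonneg
    obtain ⟨q, hyq, hqx⟩ := exists_rat_btwn hy
    rw [lt_min_iff] at hqx
    have hle : P.real (A q) ≤ P.real (U ⁻¹' Set.Iio x) := by
      refine measureReal_mono ?_
      rw [show U ⁻¹' Set.Iio x = {ω | U ω < x} from rfl, hUlt]
      exact Set.subset_biUnion_of_mem (u := fun q : ℚ => A q)
        ⟨by exact_mod_cast hy0.trans hyq.le, hqx.1⟩
    rw [hAP, min_eq_left hqx.2.le, max_eq_right (hy0.trans hyq.le)] at hle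
    exact hyq.trans_le hle
  refine Measure.ext_of_Ici _ _ fun x => ?_
  rw [← Set.compl_Iio, prob_compl_eq_one_sub measurableSet_Iio,
    prob_compl_eq_one_sub measurableSet_Iio, (measureReal_eq_measureReal_iff).1 (hcdf x)]

theorem unif01_eq_restrict_Ioc : unif01 = volume.restrict (Set.Ioc (0 : ℝ) 1) :=
  Measure.restrict_congr_set Ioc_ae_eq_Icc.symm

theorem unif01_eq_restrict_Ico : unif01 = volume.restrict (Set.Ico (0 : ℝ) 1) :=
  Measure.restrict_congr_set Ico_ae_eq_Icc.symm

/-- The uniform law is invariant under rotations of the circle `ℝ / ℤ`. -/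
theorem map_fract_sub_unif01 (c : ℝ) : unif01.map (fun x => Int.fract (x - c)) = unif01 := by
  have hm : Measurable fun x : ℝ => Int.fract (x - c) := by fun_prop
  ext S hS
  have hper : ∀ g : AddSubgroup.zmultiples (1 : ℝ),
      (fun x => g +ᵥ x) ⁻¹' (Int.fract ⁻¹' S : Set ℝ) = Int.fract ⁻¹' S := by
    rintro ⟨_, n, rfl⟩
    ext x
    simp [AddSubgroup.vadd_def]
  have hI : MeasurableSet (Int.fract ⁻¹' S : Set ℝ) := measurable_fract hS
  rw [Measure.map_apply hm hS]
  calc unif01 ((fun x => Int.fract (x - c)) ⁻¹' S)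
      = volume ((fun x => x - c) ⁻¹' (Int.fract ⁻¹' S ∩ Set.Ioc (-c) (-c + 1))) := by
        rw [unif01_eq_restrict_Ioc, Measure.restrict_apply (hm hS)]
        congr 1
        ext x
        simp only [Set.mem_inter_iff, Set.mem_preimage, Set.mem_Ioc]
        constructor <;> rintro ⟨h1, h2, h3⟩ <;> exact ⟨h1, by linarith, by linarith⟩
    _ = volume (Int.fract ⁻¹' S ∩ Set.Ioc (-c) (-c + 1)) :=
        (measurePreserving_sub_right volume c).measure_preimage
          (hI.inter measurableSet_Ioc).nullMeasurableSet
    _ = volume (Int.fract ⁻¹' S ∩ Set.Ioc 0 (0 + 1)) :=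
        (isAddFundamentalDomain_Ioc one_pos (-c)).measure_set_eq
          (isAddFundamentalDomain_Ioc one_pos 0) hI hper
    _ = unif01 (Int.fract ⁻¹' S) := by
        rw [unif01_eq_restrict_Ioc, Measure.restrict_apply hI, zero_add]
    _ = unif01 S := by
        rw [unif01_eq_restrict_Ico, Measure.restrict_apply hI, Measure.restrict_apply hS]
        congr 1
        ext x
        simp only [Set.mem_inter_iff, Set.mem_preimage, and_congr_left_iff]
        intro hx
        rw [Int.fract_eq_self.2 hx]

theorem lQuantile_eq_of_forall_iff {Ω : Type*} [MeasurableSpace Ω]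
    {P : MeasureTheory.Measure Ω} {X : Ω → ℝ} {ε a : ℝ}
    (h : ∀ x, ε ≤ P.real {ω | X ω ≤ x} ↔ a ≤ x) : lQuantile P X ε = a := by
  have : {x : ℝ | ε ≤ (P {ω | X ω ≤ x}).toReal} = Set.Ici a := Set.ext h
  rw [lQuantile, this, csInf_Ici]

theorem IsUnif.real_le {Ω : Type*} [MeasurableSpace Ω] {P : MeasureTheory.Measure Ω}
    {U : Ω → ℝ} (hU : IsUnif P U) (x : ℝ) : P.real {ω | U ω ≤ x} = max 0 (min x 1) := by
  rw [← unif01_real_Iic, ← hU.2, map_measureReal_apply hU.1 measurableSet_Iic]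
  rfl

section Bonferroni

variable {Ω : Type*} [MeasurableSpace Ω] {P : MeasureTheory.Measure Ω}
  {K : ℕ} {ε : ℝ}

theorem div_le_of_le_real_inf' (hK : (Finset.univ : Finset (Fin K)).Nonempty) (hε : 0 < ε)
    {U : Fin K → Ω → ℝ} (hU : ∀ i, IsUnif P (U i)) {x : ℝ}
    (hx : ε ≤ P.real {ω | Finset.univ.inf' hK (fun i => U i ω) ≤ x}) : ε / K ≤ x := by
  have hK0 : (0 : ℝ) < K := by
    have := Finset.card_pos.2 hK
    rw [Finset.card_fin] at this
    exact_mod_cast this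
  have hset : {ω | Finset.univ.inf' hK (fun i => U i ω) ≤ x} = ⋃ i, {ω | U i ω ≤ x} := by
    ext ω
    simp [Finset.inf'_le_iff]
  have h1 : ε ≤ K * max 0 (min x 1) := by
    rw [hset] at hx
    refine (hx.trans (measureReal_iUnion_fintype_le _)).trans_eq ?_
    simp [(hU _).real_le]
  rw [div_le_iff₀' hK0]
  rcases le_total x 0 with hx0 | hx0
  · rw [max_eq_left ((min_le_left _ _).trans hx0)] at h1
    linarith
  · refine h1.trans ?_
    gcongr
    exact max_le hx0 (min_le_left _ _)

theorem div_le_lQuantile_inf' [IsProbabilityMeasure P]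
    (hK : (Finset.univ : Finset (Fin K)).Nonempty) (hε : 0 < ε)
    (hε1 : ε ≤ 1) {U : Fin K → Ω → ℝ} (hU : ∀ i, IsUnif P (U i)) :
    ε / K ≤ lQuantile P (fun ω => Finset.univ.inf' hK (fun i => U i ω)) ε := by
  refine le_csInf ⟨1, ?_⟩ fun x hx => div_le_of_le_real_inf' hK hε hU hx
  obtain ⟨i, hi⟩ := id hK
  have h1 : P.real {ω | U i ω ≤ 1} = 1 := by simp [(hU i).real_le]
  refine (hε1.trans_eq h1.symm).trans (measureReal_mono fun ω hω => ?_)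
  exact (Finset.inf'_le (fun i => U i ω) hi).trans hω

theorem exists_lQuantile_inf'_le [IsProbabilityMeasure P] (hP : Atomless P)
    (hK : (Finset.univ : Finset (Fin K)).Nonempty) (hε : 0 < ε) (hε1 : ε ≤ 1) :
    ∃ U : Fin K → Ω → ℝ, (∀ i, IsUnif P (U i)) ∧
      lQuantile P (fun ω => Finset.univ.inf' hK (fun i => U i ω)) ε ≤ ε / K := by
  obtain ⟨V, hVm, hV⟩ := hP.exists_isUnif
  have hK0 : (0 : ℝ) < K := by
    have := Finset.card_pos.2 hK
    rw [Finset.card_fin] at this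
    exact_mod_cast this
  set δ := ε / K with hδ
  have hδ0 : 0 < δ := div_pos hε hK0
  let U : Fin K → Ω → ℝ := fun i ω => Int.fract (V ω - i * δ)
  have hU i : IsUnif P (U i) := by
    have hm : Measurable fun x : ℝ => Int.fract (x - i * δ) := by fun_prop
    refine ⟨hm.comp hVm, ?_⟩
    rw [show U i = (fun x => Int.fract (x - i * δ)) ∘ V from rfl, ← Measure.map_map hm hVm, hV,
      map_fract_sub_unif01]
  refine ⟨U, hU, csInf_le ⟨δ, fun x hx => div_le_of_le_real_inf' hK hε hU hx⟩ ?_⟩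
  have hreal : P.real (V ⁻¹' Set.Ico 0 ε) = ε := by
    rw [← map_measureReal_apply hVm measurableSet_Ico, hV, unif01,
      measureReal_restrict_apply measurableSet_Ico, Set.inter_eq_left.2, Real.volume_real_Ico]
    · simp [hε.le]
    · exact fun x hx => ⟨hx.1, hx.2.le.trans hε1⟩
  refine hreal.symm.trans_le (measureReal_mono fun ω hω => ?_)
  have h0 : 0 ≤ V ω / δ := div_nonneg hω.1 hδ0.le
  have hlt : ⌊V ω / δ⌋₊ < K := by
    rw [Nat.floor_lt h0, div_lt_iff₀ hδ0, hδ, mul_div_cancel₀ _ hK0.ne']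
    exact hω.2
  have hl : ⌊V ω / δ⌋₊ * δ ≤ V ω := (le_div_iff₀ hδ0).1 (Nat.floor_le h0)
  have hr : V ω < (⌊V ω / δ⌋₊ + 1) * δ := (div_lt_iff₀ hδ0).1 (Nat.lt_floor_add_one _)
  refine (Finset.inf'_le (fun i => U i ω) (Finset.mem_univ ⟨_, hlt⟩)).trans ?_
  have hfr : Int.fract (V ω - ⌊V ω / δ⌋₊ * δ) = V ω - ⌊V ω / δ⌋₊ * δ := by
    refine Int.fract_eq_self.2 ⟨by linarith, ?_⟩
    have : (0 : ℝ) ≤ ⌊V ω / δ⌋₊ * δ := by positivity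
    have := hω.2
    linarith
  change Int.fract (V ω - ⌊V ω / δ⌋₊ * δ) ≤ δ
  rw [hfr]
  linarith

theorem lQuantile_pi_inf' (hK : (Finset.univ : Finset (Fin K)).Nonempty) (hε : 0 < ε)
    (hε1 : ε < 1) :
    lQuantile (Measure.pi fun _ : Fin K => unif01) (fun p => Finset.univ.inf' hK p) ε
      = 1 - (1 - ε) ^ ((K : ℝ)⁻¹) := by
  have hK0 : K ≠ 0 := by
    have := Finset.card_pos.2 hK
    rw [Finset.card_fin] at this
    exact this.ne'
  refine lQuantile_eq_of_forall_iff fun x => ?_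
  have hset : {p : Fin K → ℝ | Finset.univ.inf' hK p ≤ x}
      = (Set.univ.pi fun _ => Set.Ioi x)ᶜ := by
    ext p
    simp [Finset.inf'_le_iff, Set.mem_pi]
  have hprob : (Measure.pi fun _ : Fin K => unif01).real {p | Finset.univ.inf' hK p ≤ x}
      = 1 - (1 - max 0 (min x 1)) ^ K := by
    rw [hset, probReal_compl_eq_one_sub (.univ_pi fun _ => measurableSet_Ioi),
      ← unif01_real_Ioi, Measure.real, Measure.pi_pi]
    simp [Measure.real]
  have hb : 0 ≤ (1 - ε) ^ ((K : ℝ)⁻¹) := Real.rpow_nonneg (by linarith) _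
  have hb1 : (1 - ε) ^ ((K : ℝ)⁻¹) < 1 :=
    Real.rpow_lt_one (by linarith) (by linarith) (by positivity)
  have hbK : ((1 - ε) ^ ((K : ℝ)⁻¹)) ^ K = 1 - ε := Real.rpow_inv_natCast_pow (by linarith) hK0
  have hy : (0 : ℝ) ≤ 1 - max 0 (min x 1) := by simp
  rw [hprob]
  calc ε ≤ 1 - (1 - max 0 (min x 1)) ^ K
      ↔ (1 - max 0 (min x 1)) ^ K ≤ ((1 - ε) ^ ((K : ℝ)⁻¹)) ^ K := by
        rw [hbK]; constructor <;> intro h <;> linarith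
    _ ↔ 1 - max 0 (min x 1) ≤ (1 - ε) ^ ((K : ℝ)⁻¹) := pow_le_pow_iff_left₀ hy hb hK0
    _ ↔ 1 - (1 - ε) ^ ((K : ℝ)⁻¹) ≤ max 0 (min x 1) := sub_le_comm
    _ ↔ 1 - (1 - ε) ^ ((K : ℝ)⁻¹) ≤ x := by
        rw [le_max_iff, le_min_iff]
        constructor
        · rintro (h | h)
          · linarith
          · exact h.1
        · exact fun h => Or.inr ⟨h, by linarith⟩

theorem lQuantile_unif01_id (hε : 0 < ε) (hε1 : ε ≤ 1) : lQuantile unif01 (fun u => u) ε = ε := by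
  refine lQuantile_eq_of_forall_iff fun x => ?_
  change ε ≤ unif01.real (Set.Iic x) ↔ ε ≤ x
  rw [unif01_real_Iic, le_max_iff, le_min_iff]
  constructor
  · rintro (h | h)
    · linarith
    · exact h.1
  · exact fun h => Or.inr ⟨h, hε1⟩

end Bonferroni

/-- thresholds of the Bonferroni combining function
`F(p) = min {p_1,…,p_K}`. -/
theorem bonferroni_thresholds
    {Ω : Type*} [MeasurableSpace Ω] (P : MeasureTheory.Measure Ω)
    [MeasureTheory.IsProbabilityMeasure P] (hP : Atomless P)
    (K : ℕ) (hK : 1 ≤ K)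
    (F : (Fin K → ℝ) → ℝ)
    (hF : F = fun p => Finset.univ.inf' (Finset.univ_nonempty_iff.mpr ⟨⟨0, hK⟩⟩) p)
    (ε : ℝ) (hε : ε ∈ Set.Ioo (0:ℝ) 1) :
    VAD P K F ε = ε / K ∧
    VI K F ε = 1 - (1 - ε) ^ ((K : ℝ)⁻¹) ∧
    VC K F ε = ε := by
  subst hF
  obtain ⟨hε0, hε1⟩ := hε
  refine ⟨?_, lQuantile_pi_inf' _ hε0 hε1, ?_⟩
  · obtain ⟨U, hU, hle⟩ := exists_lQuantile_inf'_le hP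
      (Finset.univ_nonempty_iff.mpr ⟨⟨0, hK⟩⟩) hε0 hε1.le
    have hlb : ∀ y ∈ {y : ℝ | ∃ U : Fin K → Ω → ℝ, (∀ i, IsUnif P (U i)) ∧
        y = lQuantile P (fun ω => Finset.univ.inf'
          (Finset.univ_nonempty_iff.mpr ⟨⟨0, hK⟩⟩) (fun i => U i ω)) ε}, ε / K ≤ y := by
      rintro _ ⟨U, hU, rfl⟩
      exact div_le_lQuantile_inf' _ hε0 hε1.le hU
    exact le_antisymm ((csInf_le ⟨_, hlb⟩ ⟨U, hU, rfl⟩).trans hle)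
      (le_csInf ⟨_, U, hU, rfl⟩ hlb)
  · simpa [VC] using lQuantile_unif01_id hε0 hε1.le
end

section
/- Let K ≥ 1 and r < 0, and let b_r(ε) = q_ε(M_{r,K}(V_1,…,V_K)) where V_1,…,V_K are independent uniform random variables on [0,1]. Then b_r(ε)/ε → K^{−1−1/r} as ε ↓ 0. -/
open MeasureTheory ProbabilityTheory Real Set Filter

/-- generalized mean combining function `M_{r,K}` for `r ≠ 0`. -/
noncomputable def Mr (r : ℝ) (K : ℕ) (p : Fin K → ℝ) : ℝ :=
  ((∑ i, p i ^ r) / (K : ℝ)) ^ r⁻¹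

open scoped Topology

/-- If `P (X < 0) = 0` and `P (X ≤ x) ∼ c * x` as `x ↓ 0`, then the left `ε`-quantile of `X` is
asymptotic to `ε / c`. -/
lemma tendsto_lQuantile_div {Ω : Type*} [MeasurableSpace Ω] (P : Measure Ω) [IsFiniteMeasure P]
    (X : Ω → ℝ) {c : ℝ} (hc : 0 < c) (h0 : ∀ x < 0, P {ω | X ω ≤ x} = 0)
    (h : Tendsto (fun x : ℝ => (P {ω | X ω ≤ x}).toReal / x) (𝓝[>] 0) (𝓝 c)) :
    Tendsto (fun ε : ℝ => lQuantile P X ε / ε) (𝓝[>] 0) (𝓝 c⁻¹) := by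
  have hscale : ∀ a : ℝ, 0 < a → Tendsto (fun ε : ℝ => a * ε) (𝓝[>] 0) (𝓝[>] 0) := by
    intro a ha
    refine tendsto_nhdsWithin_iff.2 ⟨?_, ?_⟩
    · have : Tendsto (fun ε : ℝ => a * ε) (𝓝 0) (𝓝 (a * 0)) := by
        exact (continuous_const.mul continuous_id).tendsto 0
      rw [mul_zero] at this
      exact this.mono_left nhdsWithin_le_nhds
    · filter_upwards [self_mem_nhdsWithin] with ε hε
      exact mul_pos ha hε
  have hmono : ∀ {x y : ℝ}, x ≤ y →
      (P {ω | X ω ≤ x}).toReal ≤ (P {ω | X ω ≤ y}).toReal := fun hxy =>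
    ENNReal.toReal_mono (measure_ne_top _ _) (measure_mono fun ω hω => le_trans hω hxy)
  have hupper : ∀ b : ℝ, c⁻¹ < b →
      ∀ᶠ ε : ℝ in 𝓝[>] 0, ε ≤ (P {ω | X ω ≤ b * ε}).toReal := by
    intro b hb
    have hb0 : 0 < b := (inv_pos.2 hc).trans hb
    have hbc : b⁻¹ < c := inv_lt_of_inv_lt₀ hc hb
    filter_upwards [(hscale b hb0).eventually (h.eventually_const_lt hbc),
      self_mem_nhdsWithin] with ε hε hpos
    have hpos' : (0 : ℝ) < ε := hpos
    rw [lt_div_iff₀ (by positivity), inv_mul_cancel_left₀ hb0.ne'] at hε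
    exact hε.le
  refine tendsto_order.2 ⟨fun a ha => ?_, fun b hb => ?_⟩
  · obtain ⟨a', ha', ha'c⟩ := exists_between (max_lt ha (inv_pos.2 hc))
    have ha0 : 0 < a' := (le_max_right _ _).trans_lt ha'
    have hac : c < a'⁻¹ := (lt_inv_comm₀ hc ha0).2 ha'c
    filter_upwards [(hscale a' ha0).eventually (h.eventually_lt_const hac),
      hupper (c⁻¹ + 1) (by linarith), self_mem_nhdsWithin] with ε hε hne hpos
    have hpos' : (0 : ℝ) < ε := hpos
    rw [div_lt_iff₀ (by positivity), inv_mul_cancel_left₀ ha0.ne'] at hε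
    refine ((le_max_left _ _).trans_lt ha').trans_le ?_
    rw [le_div_iff₀ hpos']
    refine le_csInf ⟨_, hne⟩ fun x hx => ?_
    by_contra! hlt
    exact absurd hε (not_lt.2 (le_trans hx (hmono hlt.le)))
  · obtain ⟨b', hb', hbb'⟩ := exists_between hb
    filter_upwards [hupper b' hb', self_mem_nhdsWithin] with ε hε hpos
    have hpos' : (0 : ℝ) < ε := hpos
    refine lt_of_le_of_lt ?_ hbb'
    rw [div_le_iff₀ hpos']
    refine csInf_le ⟨0, fun x hx => ?_⟩ hε
    by_contra! hlt
    have hx' : ε ≤ (P {ω | X ω ≤ x}).toReal := hx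
    rw [h0 x hlt, ENNReal.toReal_zero] at hx'
    linarith

lemma unif01_real_Iic_le {v : ℝ} (hv : 0 ≤ v) : unif01.real (Iic v) ≤ v := by
  have hsub : Iic v ∩ Icc (0 : ℝ) 1 ⊆ Icc 0 v := fun x hx => ⟨hx.2.1, hx.1⟩
  calc unif01.real (Iic v) = volume.real (Iic v ∩ Icc (0 : ℝ) 1) := by
        rw [unif01, measureReal_restrict_apply measurableSet_Iic]
    _ ≤ volume.real (Icc 0 v) := measureReal_mono hsub (by simp)
    _ = v := by simp [hv]

lemma unif01_real_Ioi_s3 {v : ℝ} (h0 : 0 ≤ v) (h1 : v ≤ 1) : unif01.real (Ioi v) = 1 - v := by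
  have : Ioi v ∩ Icc (0 : ℝ) 1 = Ioc v 1 := by
    ext x
    simp only [mem_inter_iff, mem_Ioi, mem_Icc, mem_Ioc]
    exact ⟨fun h => ⟨h.1, h.2.2⟩, fun h => ⟨h.1, h0.trans h.1.le, h.2⟩⟩
  rw [unif01, measureReal_restrict_apply measurableSet_Ioi, this]
  simp [h1]

lemma ae_pi_unif01_pos (K : ℕ) :
    ∀ᵐ p ∂(Measure.pi fun _ : Fin K => unif01), ∀ i, 0 < p i := by
  refine ae_all_iff.2 fun i => ?_
  have h : ∀ᵐ x ∂unif01, 0 < x := by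
    have h1 : ∀ᵐ x ∂unif01, x ∈ Icc (0 : ℝ) 1 := ae_restrict_mem measurableSet_Icc
    have h2 : ∀ᵐ x ∂unif01, x ≠ 0 :=
      ae_restrict_of_ae (Measure.ae_ne volume (0 : ℝ))
    filter_upwards [h1, h2] with x hx hx0
    exact lt_of_le_of_ne hx.1 (Ne.symm hx0)
  exact (measurePreserving_eval (fun _ : Fin K => unif01) i).quasiMeasurePreserving.ae h

/-- For a set `s` of coordinates, the probability that all of them are at most `v`. -/
lemma pi_unif01_real_forall_le {K : ℕ} (s : Finset (Fin K)) {v : ℝ} (hv : 0 ≤ v) :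
    (Measure.pi fun _ : Fin K => unif01).real {p | ∀ i ∈ s, p i ≤ v} ≤ v ^ s.card := by
  classical
  have hset : {p : Fin K → ℝ | ∀ i ∈ s, p i ≤ v} =
      Set.pi univ fun i => if i ∈ s then Iic v else univ := by
    ext p
    simp only [mem_ofPred_eq, Set.mem_pi, mem_univ, true_imp_iff]
    refine forall_congr' fun i => ?_
    split_ifs with h <;> simp [h]
  have hfac : ∀ i : Fin K, unif01.real (if i ∈ s then Iic v else univ) =
      if i ∈ s then unif01.real (Iic v) else 1 := by
    intro i
    split_ifs <;> simp
  rw [hset, measureReal_def, Measure.pi_pi, ENNReal.toReal_prod]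
  simp only [← measureReal_def, hfac]
  rw [Finset.prod_ite_mem, Finset.univ_inter, Finset.prod_const]
  exact pow_le_pow_left₀ measureReal_nonneg (unif01_real_Iic_le hv) _

lemma pi_unif01_real_exists_le (K : ℕ) {v : ℝ} (h0 : 0 ≤ v) (h1 : v ≤ 1) :
    (Measure.pi fun _ : Fin K => unif01).real {p | ∃ i, p i ≤ v} = 1 - (1 - v) ^ K := by
  have hset : {p : Fin K → ℝ | ∃ i, p i ≤ v} = (Set.pi univ fun _ => Ioi v)ᶜ := by
    ext p
    simp
  rw [hset, probReal_compl_eq_one_sub (MeasurableSet.univ_pi fun _ => measurableSet_Ioi),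
    measureReal_def, Measure.pi_pi, ENNReal.toReal_prod]
  simp only [← measureReal_def, unif01_real_Ioi_s3 h0 h1, Finset.prod_const, Finset.card_univ,
    Fintype.card_fin]

lemma Mr_le_iff {K : ℕ} (hK : 1 ≤ K) {r : ℝ} (hr : r < 0) {p : Fin K → ℝ} (hp : ∀ i, 0 < p i)
    {x : ℝ} (hx : 0 < x) : Mr r K p ≤ x ↔ K * x ^ r ≤ ∑ i, p i ^ r := by
  have hK0 : (0 : ℝ) < K := by exact_mod_cast hK
  have hne : (Finset.univ : Finset (Fin K)).Nonempty := ⟨⟨0, hK⟩, Finset.mem_univ _⟩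
  have hsum : 0 < ∑ i, p i ^ r := Finset.sum_pos (fun i _ => rpow_pos_of_pos (hp i) r) hne
  rw [Mr, rpow_inv_le_iff_of_neg (div_pos hsum hK0) hx hr, le_div_iff₀ hK0, mul_comm]

/-- If `w 0, …, w (K - 1)` have sum at least `K * y`, then either one of them is at least
`(1 - δ) * (K * y)` or two of them are at least `δ * y`. -/
lemma exists_large_of_le_sum {K : ℕ} (hK : 1 ≤ K) {w : Fin K → ℝ} {y δ : ℝ} (hδy : 0 ≤ δ * y)
    (h : K * y ≤ ∑ i, w i) :
    (∃ i, (1 - δ) * (K * y) ≤ w i) ∨ ∃ i j, i ≠ j ∧ δ * y ≤ w i ∧ δ * y ≤ w j := by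
  classical
  by_contra! hcon
  obtain ⟨hone, htwo⟩ := hcon
  have hne : (Finset.univ : Finset (Fin K)).Nonempty := ⟨⟨0, hK⟩, Finset.mem_univ _⟩
  obtain ⟨i, -, hi⟩ := Finset.exists_max_image Finset.univ w hne
  have hrest : ∀ j ∈ Finset.univ.erase i, w j ≤ δ * y := by
    intro j hj
    by_contra! hlt
    exact (htwo i j (Finset.ne_of_mem_erase hj).symm
      (hlt.le.trans (hi j (Finset.mem_univ j)))).not_gt hlt
  have hsum := Finset.sum_le_card_nsmul _ _ _ hrest
  rw [Finset.card_erase_of_mem (Finset.mem_univ i), Finset.card_univ, Fintype.card_fin,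
    nsmul_eq_mul, Nat.cast_sub hK, Nat.cast_one] at hsum
  have htotal := Finset.add_sum_erase Finset.univ w (Finset.mem_univ i)
  have hmax := hone i
  linarith

/-- For every `δ ∈ (0, 1)`, a bound on the lower tail of the generalized mean of independent
uniform variables. -/
lemma pi_unif01_real_Mr_le {K : ℕ} (hK : 1 ≤ K) {r : ℝ} (hr : r < 0) {δ : ℝ} (hδ0 : 0 < δ)
    (hδ1 : δ < 1) {x : ℝ} (hx : 0 < x) :
    (Measure.pi fun _ : Fin K => unif01).real {p | Mr r K p ≤ x} ≤
      K * (((1 - δ) * K) ^ r⁻¹ * x) + K * (K * (δ ^ r⁻¹ * x) ^ 2) := by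
  classical
  have hK0 : (0 : ℝ) < K := by exact_mod_cast hK
  have hδ1' : 0 < 1 - δ := sub_pos.2 hδ1
  set μ : Measure (Fin K → ℝ) := Measure.pi fun _ : Fin K => unif01
  set v := ((1 - δ) * K) ^ r⁻¹ * x with hv
  set w := δ ^ r⁻¹ * x with hw
  have hv0 : 0 ≤ v := by positivity
  have hw0 : 0 ≤ w := by positivity
  have hxr : 0 < x ^ r := rpow_pos_of_pos hx r
  have hinv : ∀ {a q : ℝ}, 0 < a → 0 < q → a * x ^ r ≤ q ^ r → q ≤ a ^ r⁻¹ * x := by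
    intro a q ha hq haq
    have := (le_rpow_inv_iff_of_neg hq (mul_pos ha hxr) hr).2 haq
    rwa [mul_rpow ha.le hxr.le, rpow_rpow_inv hx.le hr.ne] at this
  let A : Fin K → Set (Fin K → ℝ) := fun i => {p | p i ≤ v}
  let B : Fin K → Fin K → Set (Fin K → ℝ) := fun i j => {p | i ≠ j ∧ p i ≤ w ∧ p j ≤ w}
  have hA : ∀ i, μ.real (A i) ≤ v := by
    intro i
    simpa [A] using pi_unif01_real_forall_le {i} hv0
  have hB : ∀ i j, μ.real (B i j) ≤ w ^ 2 := by
    intro i j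
    by_cases hij : i = j
    · have : B i j = ∅ := by
        ext p
        simp [B, hij]
      rw [this, measureReal_empty]
      positivity
    · have : B i j = {p | ∀ k ∈ ({i, j} : Finset (Fin K)), p k ≤ w} := by
        ext p
        simp [B, hij]
      rw [this, ← Finset.card_pair hij]
      exact pi_unif01_real_forall_le _ hw0
  have hsub : {p | Mr r K p ≤ x} ≤ᵐ[μ] ((⋃ i, A i) ∪ ⋃ i, ⋃ j, B i j : Set (Fin K → ℝ)) := by
    filter_upwards [ae_pi_unif01_pos K] with p hp hle
    have hsum := (Mr_le_iff hK hr hp hx).1 hle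
    rcases exists_large_of_le_sum hK (mul_pos hδ0 hxr).le hsum with ⟨i, hi⟩ | ⟨i, j, hij, hi, hj⟩
    · rw [← mul_assoc] at hi
      exact Or.inl (mem_iUnion.2 ⟨i, hinv (mul_pos hδ1' hK0) (hp i) hi⟩)
    · exact Or.inr (mem_iUnion₂.2 ⟨i, j, hij, hinv hδ0 (hp i) hi, hinv hδ0 (hp j) hj⟩)
  calc μ.real {p | Mr r K p ≤ x}
      ≤ μ.real ((⋃ i, A i) ∪ ⋃ i, ⋃ j, B i j) :=
        ENNReal.toReal_mono (measure_ne_top _ _) (measure_mono_ae hsub)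
    _ ≤ μ.real (⋃ i, A i) + μ.real (⋃ i, ⋃ j, B i j) := measureReal_union_le _ _
    _ ≤ ∑ i, μ.real (A i) + ∑ i, ∑ j, μ.real (B i j) := by
        refine add_le_add (measureReal_iUnion_fintype_le _)
          ((measureReal_iUnion_fintype_le _).trans ?_)
        exact Finset.sum_le_sum fun i _ => measureReal_iUnion_fintype_le _
    _ ≤ ∑ _i : Fin K, v + ∑ _i : Fin K, ∑ _j : Fin K, w ^ 2 :=
        add_le_add (Finset.sum_le_sum fun i _ => hA i)
          (Finset.sum_le_sum fun i _ => Finset.sum_le_sum fun j _ => hB i j)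
    _ = K * v + K * (K * w ^ 2) := by simp

lemma le_pi_unif01_real_Mr {K : ℕ} (hK : 1 ≤ K) {r : ℝ} (hr : r < 0) {x : ℝ} (hx : 0 < x)
    (hx1 : (K : ℝ) ^ r⁻¹ * x ≤ 1) :
    1 - (1 - (K : ℝ) ^ r⁻¹ * x) ^ K ≤
      (Measure.pi fun _ : Fin K => unif01).real {p | Mr r K p ≤ x} := by
  have hK0 : (0 : ℝ) < K := by exact_mod_cast hK
  have hxr : 0 < x ^ r := rpow_pos_of_pos hx r
  rw [← pi_unif01_real_exists_le K (by positivity) hx1]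
  refine ENNReal.toReal_mono (measure_ne_top _ _) (measure_mono_ae ?_)
  filter_upwards [ae_pi_unif01_pos K] with p hp hle
  obtain ⟨i, hi⟩ := hle
  rw [← rpow_rpow_inv hx.le hr.ne, ← mul_rpow hK0.le hxr.le,
    le_rpow_inv_iff_of_neg (hp i) (mul_pos hK0 hxr) hr] at hi
  exact (Mr_le_iff hK hr hp hx).2 (hi.trans
    (Finset.single_le_sum (f := fun j => p j ^ r) (fun j _ => rpow_nonneg (hp j).le r)
      (Finset.mem_univ i)))

lemma tendsto_pi_unif01_Mr_div {K : ℕ} (hK : 1 ≤ K) {r : ℝ} (hr : r < 0) :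
    Tendsto (fun x : ℝ => (Measure.pi fun _ : Fin K => unif01).real {p | Mr r K p ≤ x} / x)
      (𝓝[>] 0) (𝓝 (K * (K : ℝ) ^ r⁻¹)) := by
  have hK0 : (0 : ℝ) < K := by exact_mod_cast hK
  set g := (K : ℝ) ^ r⁻¹ with hg
  have hzero : Tendsto (fun x : ℝ => x) (𝓝[>] 0) (𝓝 0) := tendsto_id.mono_left nhdsWithin_le_nhds
  refine tendsto_order.2 ⟨fun a ha => ?_, fun b hb => ?_⟩
  · have hderiv : HasDerivAt (fun x : ℝ => 1 - (1 - g * x) ^ K) (K * g) 0 := by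
      have := ((((hasDerivAt_id (0 : ℝ)).const_mul g).const_sub 1).pow K).const_sub 1
      simpa using this
    have hslope := hderiv.tendsto_slope_zero_right
    simp only [zero_add, mul_zero, sub_zero, one_pow, sub_self, smul_eq_mul] at hslope
    have hsmall : ∀ᶠ x : ℝ in 𝓝[>] 0, g * x < 1 := by
      have := hzero.const_mul g
      rw [mul_zero] at this
      exact this.eventually_lt_const one_pos
    filter_upwards [hslope.eventually_const_lt ha, hsmall, self_mem_nhdsWithin] with x h1 h2 h3
    have hx : (0 : ℝ) < x := h3
    refine h1.trans_le ?_
    rw [inv_mul_eq_div]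
    exact div_le_div_of_nonneg_right (le_pi_unif01_real_Mr hK hr hx h2.le) hx.le
  · have hcont : Tendsto (fun δ : ℝ => K * ((1 - δ) * K) ^ r⁻¹) (𝓝[>] 0) (𝓝 (K * g)) := by
      have hbase : Tendsto (fun δ : ℝ => (1 - δ) * K) (𝓝[>] 0) (𝓝 ((1 - 0) * K)) :=
        (hzero.const_sub 1).mul_const _
      rw [sub_zero, one_mul] at hbase
      exact (hbase.rpow_const (Or.inl hK0.ne')).const_mul _
    obtain ⟨δ, hδb, hδ1, hδ0⟩ := ((hcont.eventually_lt_const hb).and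
      ((hzero.eventually_lt_const one_pos).and self_mem_nhdsWithin)).exists
    have hbound : Tendsto
        (fun x : ℝ => K * ((1 - δ) * K) ^ r⁻¹ + K * (K * ((δ ^ r⁻¹) ^ 2 * x))) (𝓝[>] 0)
        (𝓝 (K * ((1 - δ) * K) ^ r⁻¹ + K * (K * ((δ ^ r⁻¹) ^ 2 * 0)))) :=
      (((hzero.const_mul _).const_mul _).const_mul _).const_add _
    simp only [mul_zero, add_zero] at hbound
    filter_upwards [hbound.eventually_lt_const hδb, self_mem_nhdsWithin] with x h1 h2
    have hx : (0 : ℝ) < x := h2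
    refine lt_of_le_of_lt ?_ h1
    rw [div_le_iff₀ hx]
    refine (pi_unif01_real_Mr_le hK hr hδ0 hδ1 hx).trans_eq ?_
    ring

/-- for `r < 0`, the VI threshold of `M_{r,K}` satisfies
`b_r(ε)/ε → K^{-1-1/r}` as `ε ↓ 0`. -/
theorem vi_asymptotic_r_neg (K : ℕ) (hK : 1 ≤ K) (r : ℝ) (hr : r < 0) :
    Filter.Tendsto (fun ε : ℝ => VI K (Mr r K) ε / ε)
      (nhdsWithin 0 (Set.Ioi 0)) (nhds ((K : ℝ) ^ (-1 - 1/r))) := by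
  have hK0 : (0 : ℝ) < K := by exact_mod_cast hK
  have hlim : (K : ℝ) ^ (-1 - 1/r) = (K * (K : ℝ) ^ r⁻¹)⁻¹ := by
    have hmul : K * (K : ℝ) ^ r⁻¹ = (K : ℝ) ^ (1 + r⁻¹) := by rw [rpow_add hK0, rpow_one]
    rw [hmul, ← rpow_neg hK0.le]
    congr 1
    ring
  rw [hlim]
  refine tendsto_lQuantile_div _ (Mr r K) (by positivity) (fun x hx => ?_)
    (tendsto_pi_unif01_Mr_div hK hr)
  rw [measure_eq_zero_iff_ae_notMem]
  filter_upwards [ae_pi_unif01_pos K] with p hpos hp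
  refine absurd (le_trans ?_ hp) (not_le.2 hx)
  exact rpow_nonneg (div_nonneg (Finset.sum_nonneg fun i _ => rpow_nonneg (hpos i).le r) hK0.le) _
end

section
/- Let K ≥ 1, r > 0, and let V_1,…,V_K be independent uniform random variables on [0,1]. Then for every x with 0 ≤ x ≤ K^{−1/r}, P(M_{r,K}(V_1,…,V_K) ≤ x) = ((Γ(1+1/r))^K / Γ(1+K/r)) · K^{K/r} · x^K, where Γ is the Gamma function. Consequently, for ε ≤ (Γ(1+1/r))^K/Γ(1+K/r), the left ε-quantile of M_{r,K}(V_1,…,V_K) equals (Γ(1+K/r))^{1/K} ε^{1/K} / (K^{1/r} Γ(1+1/r)). -/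
open MeasureTheory ProbabilityTheory Real Set Filter

/-- The part of the `ℓ^r` ball of radius `s` lying in the nonnegative orthant. -/
def orthantBall (r : ℝ) (K : ℕ) (s : ℝ) : Set (Fin K → ℝ) :=
  {p | (∀ i, 0 ≤ p i) ∧ ∑ i, p i ^ r ≤ s ^ r}

open scoped Pointwise in
theorem smul_orthantBall_one {r : ℝ} (hr : 0 < r) {K : ℕ} {s : ℝ} (hs : 0 ≤ s) :
    s • orthantBall r K 1 = orthantBall r K s := by
  ext p
  constructor
  · rintro ⟨q, ⟨hq, hq1⟩, rfl⟩
    refine ⟨fun i => mul_nonneg hs (hq i), ?_⟩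
    simp only [Pi.smul_apply, smul_eq_mul]
    rw [Finset.sum_congr rfl fun i _ => Real.mul_rpow hs (hq i), ← Finset.mul_sum]
    rw [Real.one_rpow] at hq1
    exact mul_le_of_le_one_right (Real.rpow_nonneg hs r) hq1
  · rintro ⟨hp, hps⟩
    rcases hs.eq_or_lt with rfl | hs0
    · rw [Real.zero_rpow hr.ne'] at hps
      have hsum : ∑ i, p i ^ r = 0 :=
        le_antisymm hps (Finset.sum_nonneg fun i _ => Real.rpow_nonneg (hp i) r)
      rw [Finset.sum_eq_zero_iff_of_nonneg fun i _ => Real.rpow_nonneg (hp i) r] at hsum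
      refine ⟨0, ⟨fun i => le_rfl, by simp [Real.zero_rpow hr.ne']⟩, ?_⟩
      ext i
      simpa using ((Real.rpow_eq_zero (hp i) hr.ne').1 (hsum i (Finset.mem_univ i))).symm
    · refine ⟨s⁻¹ • p, ⟨fun i => mul_nonneg (inv_nonneg.2 hs) (hp i), ?_⟩,
        smul_inv_smul₀ hs0.ne' p⟩
      simp only [Pi.smul_apply, smul_eq_mul]
      rw [Finset.sum_congr rfl fun i _ => Real.mul_rpow (inv_nonneg.2 hs) (hp i),
        ← Finset.mul_sum, Real.one_rpow, Real.inv_rpow hs, inv_mul_le_iff₀ (Real.rpow_pos_of_pos hs0 r), mul_one]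
      exact hps

theorem volume_orthantBall_eq_mul {r : ℝ} (hr : 0 < r) {K : ℕ} {s : ℝ} (hs : 0 ≤ s) :
    volume (orthantBall r K s) = ENNReal.ofReal (s ^ K) * volume (orthantBall r K 1) := by
  rw [← smul_orthantBall_one hr hs, Measure.addHaar_smul, Module.finrank_fin_fun,
    abs_of_nonneg (pow_nonneg hs K)]

theorem integrableOn_exp_neg_rpow {r : ℝ} (hr : 0 < r) :
    IntegrableOn (fun x : ℝ => Real.exp (-x ^ r)) (Ioi 0) := by
  simpa using integrableOn_rpow_mul_exp_neg_rpow (s := 0) (by norm_num) hr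

theorem lintegral_exp_neg_sum_rpow {r : ℝ} (hr : 0 < r) (K : ℕ) :
    ∫⁻ p in univ.pi fun _ : Fin K => Ici (0 : ℝ), ENNReal.ofReal (Real.exp (-∑ i, p i ^ r))
      = ENNReal.ofReal (Real.Gamma (1 + 1 / r) ^ K) := by
  have hexp (p : Fin K → ℝ) : Real.exp (-∑ i, p i ^ r) = ∏ i, Real.exp (-p i ^ r) := by
    rw [← Finset.sum_neg_distrib, Real.exp_sum]
  simp_rw [hexp]
  rw [volume_pi, Measure.restrict_pi_pi, ← ofReal_integral_eq_lintegral_ofReal,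
    integral_fintype_prod_eq_prod (fun _ x => Real.exp (-x ^ r))]
  · rw [integral_Ici_eq_integral_Ioi, integral_exp_neg_rpow hr, Finset.prod_const,
      Finset.card_univ, Fintype.card_fin, add_comm]
  · exact Integrable.fintype_prod fun _ =>
      ((integrableOn_Ici_iff_integrableOn_Ioi).2 (integrableOn_exp_neg_rpow hr))
  · exact .of_forall fun p => Finset.prod_nonneg fun i _ => (Real.exp_pos _).le

theorem lintegral_Ici_exp_neg (a : ℝ) :
    ∫⁻ t in Ici a, ENNReal.ofReal (Real.exp (-t)) = ENNReal.ofReal (Real.exp (-a)) := by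
  rw [← ofReal_integral_eq_lintegral_ofReal
    ((integrableOn_Ici_iff_integrableOn_Ioi).2 (integrableOn_exp_neg_Ioi a))
    (.of_forall fun t => (Real.exp_pos _).le), integral_Ici_eq_integral_Ioi, integral_exp_neg_Ioi]

theorem lintegral_exp_neg_mul_rpow {s : ℝ} (hs : 0 ≤ s) :
    ∫⁻ t in Ici (0 : ℝ), ENNReal.ofReal (Real.exp (-t) * t ^ s)
      = ENNReal.ofReal (Real.Gamma (1 + s)) := by
  have hs1 : 0 < 1 + s := by linarith
  have hint := Real.GammaIntegral_convergent hs1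
  have heq := Real.Gamma_eq_integral hs1
  simp only [add_sub_cancel_left] at hint heq
  rw [heq, ← integral_Ici_eq_integral_Ioi, ofReal_integral_eq_lintegral_ofReal
    ((integrableOn_Ici_iff_integrableOn_Ioi).2 hint)]
  filter_upwards [ae_restrict_mem measurableSet_Ici] with t ht
  exact mul_nonneg (Real.exp_pos _).le (Real.rpow_nonneg ht s)

theorem volume_orthantBall_one_mul {r : ℝ} (hr : 0 < r) (K : ℕ) :
    volume (orthantBall r K 1) * ENNReal.ofReal (Real.Gamma (1 + K / r))
      = ENNReal.ofReal (Real.Gamma (1 + 1 / r) ^ K) := by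
  set Q : Set (Fin K → ℝ) := univ.pi fun _ => Ici 0 with hQ
  have hQm : MeasurableSet Q := .univ_pi fun _ => measurableSet_Ici
  have hfm : Measurable fun p : Fin K → ℝ => ∑ i, p i ^ r := by fun_prop
  have hpt (p : Fin K → ℝ) (hp : p ∈ Q) : ENNReal.ofReal (Real.exp (-∑ i, p i ^ r)) =
      ∫⁻ t in Ici (0 : ℝ),
        (Ici (∑ i, p i ^ r)).indicator (fun t => ENNReal.ofReal (Real.exp (-t))) t := by
    have h0 : 0 ≤ ∑ i, p i ^ r :=
      Finset.sum_nonneg fun i _ => Real.rpow_nonneg (hp i (mem_univ i)) r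
    rw [lintegral_indicator measurableSet_Ici, Measure.restrict_restrict measurableSet_Ici,
      inter_eq_left.2 (Ici_subset_Ici.2 h0), lintegral_Ici_exp_neg]
  have hslice (t : ℝ) (ht : t ∈ Ici (0 : ℝ)) :
      ∫⁻ p in Q, (Ici (∑ i, p i ^ r)).indicator (fun t => ENNReal.ofReal (Real.exp (-t))) t
        = volume (orthantBall r K 1) * ENNReal.ofReal (Real.exp (-t) * t ^ ((K : ℝ) / r)) := by
    have hind : (fun p : Fin K → ℝ =>
        (Ici (∑ i, p i ^ r)).indicator (fun t => ENNReal.ofReal (Real.exp (-t))) t)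
        = {p | ∑ i, p i ^ r ≤ t}.indicator fun _ => ENNReal.ofReal (Real.exp (-t)) := by
      ext p
      simp [indicator_apply]
    have hset : {p : Fin K → ℝ | ∑ i, p i ^ r ≤ t} ∩ Q = orthantBall r K (t ^ (1 / r)) := by
      ext p
      rw [orthantBall, ← Real.rpow_mul ht, one_div_mul_cancel hr.ne', Real.rpow_one]
      simp [hQ, and_comm, Pi.le_def]
    rw [hind, lintegral_indicator_const (measurableSet_le hfm measurable_const),
      Measure.restrict_apply' hQm, hset, volume_orthantBall_eq_mul hr (Real.rpow_nonneg ht _),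
      ← Real.rpow_mul_natCast ht, ← mul_assoc, ← ENNReal.ofReal_mul (Real.exp_pos _).le,
      mul_comm, one_div_mul_eq_div]
  rw [← lintegral_exp_neg_sum_rpow hr K, ← lintegral_exp_neg_mul_rpow (by positivity),
    ← lintegral_const_mul _ (by fun_prop), setLIntegral_congr_fun hQm hpt, lintegral_lintegral_swap,
    setLIntegral_congr_fun measurableSet_Ici hslice]
  refine Measurable.aemeasurable ?_
  have hm : Measurable fun q : (Fin K → ℝ) × ℝ => ENNReal.ofReal (Real.exp (-q.2)) := by fun_prop
  exact hm.indicator (measurableSet_le (hfm.comp measurable_fst) measurable_snd)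

theorem volume_orthantBall {r : ℝ} (hr : 0 < r) (K : ℕ) {s : ℝ} (hs : 0 ≤ s) :
    volume (orthantBall r K s) =
      ENNReal.ofReal (s ^ K * (Real.Gamma (1 + 1 / r) ^ K / Real.Gamma (1 + K / r))) := by
  have hΓ : 0 < Real.Gamma (1 + K / r) := Real.Gamma_pos_of_pos (by positivity)
  rw [volume_orthantBall_eq_mul hr hs, ENNReal.ofReal_mul (pow_nonneg hs K),
    ENNReal.ofReal_div_of_pos hΓ, ← volume_orthantBall_one_mul hr K,
    ENNReal.mul_div_cancel_right (by simpa using hΓ) ENNReal.ofReal_ne_top]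

theorem pi_unif01_apply (K : ℕ) (s : Set (Fin K → ℝ)) :
    (Measure.pi fun _ : Fin K => unif01) s = volume (s ∩ univ.pi fun _ => Icc 0 1) := by
  rw [volume_pi, ← Measure.restrict_apply' (.univ_pi fun _ => measurableSet_Icc),
    Measure.restrict_pi_pi]
  rfl

theorem setOf_Mr_le_inter {K : ℕ} (hK : 1 ≤ K) {r : ℝ} (hr : 0 < r) {x : ℝ} (hx : 0 ≤ x)
    (hx1 : x ≤ (K : ℝ) ^ (-(1 / r))) :
    {p | Mr r K p ≤ x} ∩ univ.pi (fun _ => Icc 0 1)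
      = orthantBall r K ((K : ℝ) ^ (1 / r) * x) := by
  have hK0 : (0 : ℝ) < K := by exact_mod_cast hK
  have hrad : ((K : ℝ) ^ (1 / r) * x) ^ r = K * x ^ r := by
    rw [Real.mul_rpow (by positivity) hx, ← Real.rpow_mul hK0.le, one_div_mul_cancel hr.ne',
      Real.rpow_one]
  have hle : ((K : ℝ) ^ (1 / r) * x) ^ r ≤ 1 := by
    refine Real.rpow_le_one (by positivity) ?_ hr.le
    rwa [Real.rpow_neg hK0.le, ← one_div, le_div_iff₀' (by positivity)] at hx1
  have hiff (p : Fin K → ℝ) (hp : ∀ i, 0 ≤ p i) :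
      Mr r K p ≤ x ↔ ∑ i, p i ^ r ≤ ((K : ℝ) ^ (1 / r) * x) ^ r := by
    have h0 : 0 ≤ ∑ i, p i ^ r := Finset.sum_nonneg fun i _ => Real.rpow_nonneg (hp i) r
    rw [hrad, Mr, Real.rpow_inv_le_iff_of_pos (by positivity) hx hr, div_le_iff₀' hK0]
  ext p
  constructor
  · rintro ⟨hM, hp⟩
    have hp0 (i) : 0 ≤ p i := (hp i (mem_univ i)).1
    exact ⟨hp0, (hiff p hp0).1 hM⟩
  · rintro ⟨hp0, hM⟩
    refine ⟨(hiff p hp0).2 hM, fun i _ => ⟨hp0 i, ?_⟩⟩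
    have h1 : p i ^ r ≤ 1 := (Finset.single_le_sum (f := fun i => p i ^ r)
      (fun j _ => Real.rpow_nonneg (hp0 j) r) (Finset.mem_univ i)).trans (hM.trans hle)
    rwa [← Real.one_rpow r, Real.rpow_le_rpow_iff (hp0 i) zero_le_one hr] at h1

theorem pi_unif01_Mr_le {K : ℕ} (hK : 1 ≤ K) {r : ℝ} (hr : 0 < r) {x : ℝ} (hx : 0 ≤ x)
    (hx1 : x ≤ (K : ℝ) ^ (-(1 / r))) :
    ((Measure.pi fun _ : Fin K => unif01) {p | Mr r K p ≤ x}).toReal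
      = Real.Gamma (1 + 1 / r) ^ K / Real.Gamma (1 + K / r) * (K : ℝ) ^ ((K : ℝ) / r) * x ^ K := by
  have hΓ : 0 < Real.Gamma (1 + K / r) := Real.Gamma_pos_of_pos (by positivity)
  have hΓ1 : 0 < Real.Gamma (1 + 1 / r) := Real.Gamma_pos_of_pos (by positivity)
  rw [pi_unif01_apply, setOf_Mr_le_inter hK hr hx hx1, volume_orthantBall hr K (by positivity),
    ENNReal.toReal_ofReal (by positivity), mul_pow, ← Real.rpow_mul_natCast (Nat.cast_nonneg K),
    one_div_mul_eq_div]
  ring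

/-- for `r > 0` and independent uniforms, the cdf of `M_{r,K}` on
`[0, K^{-1/r}]` is `(Γ(1+1/r))^K/Γ(1+K/r) · K^{K/r} · x^K`; consequently for
`ε ≤ (Γ(1+1/r))^K/Γ(1+K/r)` the left `ε`-quantile equals
`(Γ(1+K/r))^{1/K} ε^{1/K} / (K^{1/r} Γ(1+1/r))`. -/
theorem vi_formula_r_pos (K : ℕ) (hK : 1 ≤ K) (r : ℝ) (hr : 0 < r) :
    (∀ x : ℝ, 0 ≤ x → x ≤ (K : ℝ) ^ (-(1/r)) →
      ((MeasureTheory.Measure.pi fun _ : Fin K => unif01) {p | Mr r K p ≤ x}).toReal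
        = (Real.Gamma (1 + 1/r)) ^ K / Real.Gamma (1 + K/r)
            * (K : ℝ) ^ ((K : ℝ)/r) * x ^ K) ∧
    (∀ ε : ℝ, 0 < ε → ε ≤ (Real.Gamma (1 + 1/r)) ^ K / Real.Gamma (1 + K/r) →
      VI K (Mr r K) ε =
        (Real.Gamma (1 + K/r)) ^ ((K : ℝ)⁻¹) * ε ^ ((K : ℝ)⁻¹)
          / ((K : ℝ) ^ (1/r) * Real.Gamma (1 + 1/r))) := by
  have hK0 : (0 : ℝ) < K := by exact_mod_cast hK
  have hKne : K ≠ 0 := Nat.ne_of_gt hK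
  have hΓ : 0 < Real.Gamma (1 + K / r) := Real.Gamma_pos_of_pos (by positivity)
  have hΓ1 : 0 < Real.Gamma (1 + 1 / r) := Real.Gamma_pos_of_pos (by positivity)
  refine ⟨fun x hx hx1 => pi_unif01_Mr_le hK hr hx hx1, fun ε hε hε1 => ?_⟩
  set y := Real.Gamma (1 + K / r) ^ ((K : ℝ)⁻¹) * ε ^ ((K : ℝ)⁻¹)
    / ((K : ℝ) ^ (1 / r) * Real.Gamma (1 + 1 / r)) with hy
  have hy0 : 0 ≤ y := by positivity
  have hyK : y ^ K = Real.Gamma (1 + K / r) * ε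
      / ((K : ℝ) ^ ((K : ℝ) / r) * Real.Gamma (1 + 1 / r) ^ K) := by
    rw [hy, div_pow, mul_pow, mul_pow, Real.rpow_inv_natCast_pow hΓ.le hKne,
      Real.rpow_inv_natCast_pow hε.le hKne, ← Real.rpow_mul_natCast hK0.le, one_div_mul_eq_div]
  have hy1 : y ≤ (K : ℝ) ^ (-(1 / r)) := by
    refine le_of_pow_le_pow_left₀ hKne (by positivity) ?_
    rw [hyK, ← Real.rpow_mul_natCast hK0.le, neg_mul, one_div_mul_eq_div, Real.rpow_neg hK0.le,
      div_le_iff₀ (by positivity), inv_mul_cancel_left₀ (by positivity)]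
    rwa [le_div_iff₀' hΓ] at hε1
  have hcdf : Real.Gamma (1 + 1 / r) ^ K / Real.Gamma (1 + K / r) * (K : ℝ) ^ ((K : ℝ) / r) * y ^ K
      = ε := by
    rw [hyK]
    field_simp
  refine IsLeast.csInf_eq ⟨?_, fun x hx => ?_⟩
  · rw [mem_ofPred_eq, pi_unif01_Mr_le hK hr hy0 hy1, hcdf]
  · by_contra! hxy
    rw [mem_ofPred_eq] at hx
    have hz0 : 0 ≤ max x 0 := le_max_right x 0
    have hzy : max x 0 < y := by
      refine max_lt hxy (by positivity)
    have hmono : ((Measure.pi fun _ : Fin K => unif01) {p | Mr r K p ≤ x}).toReal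
        ≤ ((Measure.pi fun _ : Fin K => unif01) {p | Mr r K p ≤ max x 0}).toReal :=
      ENNReal.toReal_mono (measure_ne_top _ _)
        (measure_mono fun p (hp : Mr r K p ≤ x) => hp.trans (le_max_left x 0))
    rw [pi_unif01_Mr_le hK hr hz0 (hzy.le.trans hy1)] at hmono
    have hlt := mul_lt_mul_of_pos_left (pow_lt_pow_left₀ hzy hz0 hKne)
      (show 0 < Real.Gamma (1 + 1 / r) ^ K / Real.Gamma (1 + K / r) * (K : ℝ) ^ ((K : ℝ) / r) by
        positivity)
    linarith
end

section
/- Let r > 0 and for each K ≥ 1 let b_r(ε) = q_ε(M_{r,K}(V_1,…,V_K)) where V_1,…,V_K are independent uniform random variables on [0,1]. Then for each fixed ε ∈ (0,1), b_r(ε) ∼ ((σ/√K)·Φ^{−1}(ε) + μ)^{1/r} as K → ∞, where μ = 1/(r+1), σ² = r²/((1+2r)(1+r)²), and Φ^{−1} is the standard normal quantile function; here A_K ∼ B_K means A_K/B_K → 1. -/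
open MeasureTheory ProbabilityTheory Real Set Filter

/-- standard normal quantile function `Φ⁻¹`. -/
noncomputable def normQuantile (p : ℝ) : ℝ :=
  sInf {x : ℝ | p ≤ ((ProbabilityTheory.gaussianReal 0 1) (Set.Iic x)).toReal}

/-- Left quantiles at a fixed level of random variables converging in probability to a constant
converge to that constant. -/
theorem tendsto_lQuantile_of_tendsto_measure {Ω : ℕ → Type*} [∀ n, MeasurableSpace (Ω n)]
    (P : ∀ n, Measure (Ω n)) [∀ n, IsProbabilityMeasure (P n)] (X : ∀ n, Ω n → ℝ) (m : ℝ)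
    (hX : ∀ δ > 0, Tendsto (fun n => P n {ω | δ ≤ |X n ω - m|}) atTop (nhds 0))
    {ε : ℝ} (hε : ε ∈ Set.Ioo (0:ℝ) 1) :
    Tendsto (fun n => lQuantile (P n) (X n) ε) atTop (nhds m) := by
  rw [Metric.tendsto_atTop']
  intro δ hδ
  have hlim : Tendsto (fun n => (P n).real {ω | δ / 2 ≤ |X n ω - m|}) atTop (nhds 0) := by
    simpa [Measure.real, Function.comp_def] using
      (ENNReal.tendsto_toReal ENNReal.zero_ne_top).comp (hX _ (half_pos hδ))
  have hev := (hlim.eventually (gt_mem_nhds hε.1)).and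
    (hlim.eventually (gt_mem_nhds (sub_pos.2 hε.2)))
  obtain ⟨N, hN⟩ := eventually_atTop.1 hev
  refine ⟨N, fun n hn => ?_⟩
  obtain ⟨hlow, hup⟩ := hN n hn.le
  have hlb : m - δ / 2 ∈ lowerBounds {x : ℝ | ε ≤ (P n {ω | X n ω ≤ x}).toReal} := by
    intro x hx
    by_contra! hlt
    refine absurd (hx.trans (measureReal_mono (μ := P n) ?_)) hlow.not_ge
    intro ω (hω : X n ω ≤ x)
    change δ / 2 ≤ |X n ω - m|
    exact le_abs.2 (Or.inr (by linarith))
  have hmem : m + δ / 2 ∈ {x : ℝ | ε ≤ (P n {ω | X n ω ≤ x}).toReal} := by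
    have hcover : (1 : ℝ) ≤
        (P n).real {ω | X n ω ≤ m + δ / 2} + (P n).real {ω | δ / 2 ≤ |X n ω - m|} := by
      rw [← probReal_univ (μ := P n)]
      refine (measureReal_mono ?_).trans (measureReal_union_le _ _)
      intro ω _
      rcases le_total (X n ω) (m + δ / 2) with h | h
      · exact Or.inl h
      · right
        change δ / 2 ≤ |X n ω - m|
        exact le_abs.2 (Or.inl (by linarith))
    change ε ≤ (P n).real _
    linarith
  have h1 : m - δ / 2 ≤ lQuantile (P n) (X n) ε := le_csInf ⟨_, hmem⟩ hlb
  have h2 : lQuantile (P n) (X n) ε ≤ m + δ / 2 := csInf_le ⟨_, hlb⟩ hmem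
  rw [Real.dist_eq, abs_lt]
  constructor <;> linarith

/-- The weak law of large numbers for finite product measures. -/
theorem tendsto_pi_measure_abs_average_sub_ge {α : Type*} [MeasurableSpace α] (ν : Measure α)
    [IsProbabilityMeasure ν] {f : α → ℝ} (hf : MemLp f 2 ν) {η : ℝ} (hη : 0 < η) :
    Tendsto (fun K : ℕ => Measure.pi (fun _ : Fin K => ν)
      {p | η ≤ |(∑ i, f (p i)) / (K : ℝ) - ∫ x, f x ∂ν|}) atTop (nhds 0) := by
  have hlim : Tendsto (fun K : ℕ => ENNReal.ofReal (variance f ν / η ^ 2 / (K : ℝ)))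
      atTop (nhds 0) := by
    simpa using ENNReal.tendsto_ofReal (tendsto_const_div_atTop_nhds_zero_nat (variance f ν / η ^ 2))
  refine tendsto_of_tendsto_of_tendsto_of_le_of_le' tendsto_const_nhds hlim
    (Eventually.of_forall fun _ => zero_le) ?_
  filter_upwards [eventually_gt_atTop 0] with K hK
  have hK' : (0 : ℝ) < K := Nat.cast_pos.2 hK
  let Q : Measure (Fin K → α) := Measure.pi fun _ => ν
  have hmp (i : Fin K) : MeasurePreserving (Function.eval i) Q ν :=
    measurePreserving_eval (fun _ => ν) i
  have hLp (i : Fin K) : MemLp (fun p : Fin K → α => f (p i)) 2 Q :=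
    hf.comp_measurePreserving (hmp i)
  have hint (i : Fin K) : ∫ p, f (p i) ∂Q = ∫ x, f x ∂ν := by
    have h := integral_map (hmp i).aemeasurable
      (f := f) (by rw [(hmp i).map_eq]; exact hf.aestronglyMeasurable)
    rw [(hmp i).map_eq] at h
    exact h.symm
  have hvar : variance (fun p => ∑ i, f (p i)) Q = K * variance f ν := by
    have h := variance_sum_pi (μ := fun _ : Fin K => ν) (X := fun _ => f) (fun _ => hf)
    simpa [Finset.sum_fn] using h
  have hsum : MemLp (fun p : Fin K → α => (∑ i, f (p i)) / (K : ℝ)) 2 Q := by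
    simpa [div_eq_inv_mul] using (memLp_finsetSum Finset.univ fun i _ => hLp i).const_mul (K : ℝ)⁻¹
  have hmean : ∫ p, (∑ i, f (p i)) / (K : ℝ) ∂Q = ∫ x, f x ∂ν := by
    rw [integral_div, integral_finsetSum _ fun i _ => (hLp i).integrable one_le_two]
    simp [hint, hK'.ne']
  have hvar' : variance (fun p => (∑ i, f (p i)) / (K : ℝ)) Q = variance f ν / K := by
    simp only [div_eq_inv_mul]
    rw [variance_const_mul, hvar]
    field_simp
  have h := meas_ge_le_variance_div_sq hsum hη
  rw [hmean, hvar'] at h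
  rwa [div_right_comm] at h

theorem memLp_rpow_unif01 {r : ℝ} (hr : 0 < r) : MemLp (fun x : ℝ => x ^ r) 2 unif01 := by
  refine MemLp.of_bound (Real.continuous_rpow_const hr.le).aestronglyMeasurable 1 ?_
  refine (ae_restrict_iff' measurableSet_Icc).2 (Eventually.of_forall fun x hx => ?_)
  rw [Real.norm_of_nonneg (Real.rpow_nonneg hx.1 r)]
  exact Real.rpow_le_one hx.1 hx.2 hr.le

theorem integral_rpow_unif01 {r : ℝ} (hr : 0 < r) : ∫ x, x ^ r ∂unif01 = (r + 1)⁻¹ := by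
  rw [unif01, integral_Icc_eq_integral_Ioc, ← intervalIntegral.integral_of_le zero_le_one,
    integral_rpow (Or.inl (by linarith))]
  simp [Real.zero_rpow (by linarith : r + 1 ≠ 0)]

/-- The independent threshold of the generalized mean converges to the `L^r` norm of a uniform
random variable. -/
theorem tendsto_VI_Mr {r : ℝ} (hr : 0 < r) {ε : ℝ} (hε : ε ∈ Set.Ioo (0:ℝ) 1) :
    Tendsto (fun K : ℕ => VI K (Mr r K) ε) atTop (nhds ((r + 1)⁻¹ ^ r⁻¹)) := by
  refine tendsto_lQuantile_of_tendsto_measure (fun K => Measure.pi fun _ : Fin K => unif01)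
    (fun K => Mr r K) _ (fun δ hδ => ?_) hε
  have hpos : (0 : ℝ) < (r + 1)⁻¹ := by positivity
  obtain ⟨η, hη, hcont⟩ := Metric.continuousAt_iff.1
    (Real.continuousAt_rpow_const (r + 1)⁻¹ r⁻¹ (Or.inl hpos.ne')) δ hδ
  have hlln := tendsto_pi_measure_abs_average_sub_ge unif01 (memLp_rpow_unif01 hr) hη
  rw [integral_rpow_unif01 hr] at hlln
  refine tendsto_of_tendsto_of_tendsto_of_le_of_le tendsto_const_nhds hlln
    (fun _ => zero_le) fun K => measure_mono fun p hp => ?_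
  by_contra hlt
  exact absurd (hcont (not_le.1 hlt)) (not_lt.2 hp)

/-- for `r > 0` and fixed `ε ∈ (0,1)`,
`b_r(ε) ∼ ((σ/√K)·Φ⁻¹(ε) + μ)^{1/r}` as `K → ∞`, where `μ = 1/(r+1)` and
`σ² = r²/((1+2r)(1+r)²)`. -/
theorem vi_asymptotic_large_K_r_pos (r : ℝ) (hr : 0 < r)
    (μ σ : ℝ) (hμ : μ = (r + 1)⁻¹) (hσ : σ = Real.sqrt (r^2 / ((1 + 2*r) * (1 + r)^2)))
    (ε : ℝ) (hε : ε ∈ Set.Ioo (0:ℝ) 1) :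
    Filter.Tendsto
      (fun K : ℕ => VI K (Mr r K) ε /
        ((σ / Real.sqrt (K : ℝ) * normQuantile ε + μ) ^ r⁻¹))
      Filter.atTop (nhds 1) := by
  have hpos : 0 < μ := hμ ▸ by positivity
  have hnum : Tendsto (fun K : ℕ => VI K (Mr r K) ε) atTop (nhds (μ ^ r⁻¹)) :=
    hμ ▸ tendsto_VI_Mr hr hε
  have hbase : Tendsto (fun K : ℕ => σ / Real.sqrt (K : ℝ) * normQuantile ε + μ)
      atTop (nhds μ) := by
    have h : Tendsto (fun K : ℕ => σ / Real.sqrt (K : ℝ)) atTop (nhds 0) :=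
      tendsto_const_nhds.div_atTop (tendsto_sqrt_atTop.comp tendsto_natCast_atTop_atTop)
    simpa using (h.mul_const (normQuantile ε)).add_const μ
  have hden := hbase.rpow_const (p := r⁻¹) (Or.inl hpos.ne')
  have hne : μ ^ r⁻¹ ≠ 0 := (Real.rpow_pos_of_pos hpos _).ne'
  simpa [Pi.div_def, div_self hne] using hnum.div hden hne
end

section
/- Let φ : (0,1) → ℝ be continuous and strictly monotone. Then the following are equivalent: (a) for every integer K ≥ 2, if V_1,…,V_K are independent uniform random variables on [0,1] and U is uniform on [0,1], then (1/K)Σ_{i=1}^K φ(V_i) has the same distribution as φ(U) (i.e., the generalized mean M_{φ,K} is IC-balanced for all K); (b) there exist real numbers a ≠ 0 and b such that φ(p) = a·tan(π(p−1/2)) + b for all p ∈ (0,1). -/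
open MeasureTheory ProbabilityTheory Real Set Filter

lemma integral_exp_mul_I_mul_cauchy (t : ℝ) :
    ∫ x : ℝ, Complex.exp (t * x * Complex.I) * ((π * (1 + x ^ 2))⁻¹ : ℝ) =
      Complex.exp (-|t| : ℝ) := by
  open scoped FourierTransform in
  let f : ℝ → ℂ := fun x => Complex.exp ((-(2 * π * |x|) : ℝ) : ℂ)
  have hπ := Real.pi_pos
  have hre1 : ∀ w : ℝ, (-(2 * π : ℂ) * (1 + w * Complex.I)).re < 0 := by
    intro w; simp [hπ]
  have hre2 : ∀ w : ℝ, 0 < ((2 * π : ℂ) * (1 - w * Complex.I)).re := by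
    intro w; simp [hπ]
  have e1 : ∀ w : ℝ, EqOn (fun v : ℝ => Complex.exp (↑(-2 * π * v * w) * Complex.I) • f v)
      (fun v : ℝ => Complex.exp ((-(2 * π : ℂ) * (1 + w * Complex.I)) * v)) (Ioi 0) := by
    intro w v hv
    simp only [f, abs_of_pos (mem_Ioi.1 hv), smul_eq_mul, ← Complex.exp_add]
    congr 1; push_cast; ring
  have e2 : ∀ w : ℝ, EqOn (fun v : ℝ => Complex.exp (↑(-2 * π * v * w) * Complex.I) • f v)
      (fun v : ℝ => Complex.exp (((2 * π : ℂ) * (1 - w * Complex.I)) * v)) (Iic 0) := by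
    intro w v hv
    simp only [f, abs_of_nonpos (mem_Iic.1 hv), smul_eq_mul, ← Complex.exp_add]
    congr 1; push_cast; ring
  have i1 := fun w => (integrableOn_congr_fun (e1 w) measurableSet_Ioi).2
    (integrableOn_exp_mul_complex_Ioi (hre1 w) 0)
  have i2 := fun w => (integrableOn_congr_fun (e2 w) measurableSet_Iic).2
    (integrableOn_exp_mul_complex_Iic (hre2 w) 0)
  have hf : Integrable f := by
    have := (i2 0).union (i1 0)
    rw [Iic_union_Ioi, integrableOn_univ] at this
    simpa using this
  have hF : 𝓕 f = fun w : ℝ => (((π * (1 + w ^ 2))⁻¹ : ℝ) : ℂ) := by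
    ext w
    rw [Real.fourier_real_eq_integral_exp_smul, ← setIntegral_univ, ← Iic_union_Ioi (a := (0:ℝ)),
      setIntegral_union (Iic_disjoint_Ioi le_rfl) measurableSet_Ioi (i2 w) (i1 w),
      setIntegral_congr_fun measurableSet_Iic (e2 w),
      setIntegral_congr_fun measurableSet_Ioi (e1 w), integral_exp_mul_complex_Ioi (hre1 w),
      integral_exp_mul_complex_Iic (hre2 w)]
    have h1 : (1 + w * Complex.I : ℂ) ≠ 0 := fun h => by simpa using congrArg Complex.re h
    have h2 : (1 - w * Complex.I : ℂ) ≠ 0 := fun h => by simpa using congrArg Complex.re h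
    have h3 : (1 + (w : ℂ) ^ 2) ≠ 0 := by
      have : (1 + (w:ℂ)^2) = (1 + w * Complex.I) * (1 - w * Complex.I) := by
        linear_combination (w:ℂ)^2 * Complex.I_sq
      rw [this]; exact mul_ne_zero h1 h2
    have h4 : (π : ℂ) ≠ 0 := by exact_mod_cast hπ.ne'
    push_cast
    simp only [mul_zero, Complex.exp_zero]
    field_simp
    linear_combination (2 * (w:ℂ)^2) * Complex.I_sq
  have hF' : Integrable (𝓕 f) := by
    rw [hF]
    have h : Integrable fun w : ℝ => (π * (1 + w ^ 2))⁻¹ :=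
      (integrable_inv_one_add_sq.const_mul π⁻¹).congr (ae_of_all _ fun w => (mul_inv _ _).symm)
    exact h.ofReal
  have hc : Continuous f := by fun_prop
  have := congrFun (hc.fourierInv_fourier_eq hf hF') (t / (2 * π))
  rw [Real.fourierInv_eq', hF] at this
  convert this using 1
  · congr 1; ext x
    rw [smul_eq_mul]
    congr 3
    simp only [RCLike.inner_apply, conj_trivial]
    push_cast
    have h4 : (π : ℂ) ≠ 0 := by exact_mod_cast hπ.ne'
    field_simp
  · simp only [f]
    congr 3
    rw [abs_div, abs_of_pos (by positivity : 0 < 2 * π)]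
    field_simp

lemma exists_eq_exp_of_add_eq_mul {c : ℝ → ℂ} (hc : Continuous c) (h0 : c 0 = 1)
    (hadd : ∀ s t, 0 ≤ s → 0 ≤ t → c (s + t) = c s * c t) :
    ∃ z : ℂ, ∀ t, 0 ≤ t → c t = Complex.exp (t * z) := by
  let G : ℝ → ℂ := fun x => ∫ u in (0:ℝ)..x, c u
  have hG : ∀ x, HasDerivAt G (c x) x := fun x =>
    intervalIntegral.integral_hasDerivAt_right (hc.intervalIntegrable _ _)
      (hc.stronglyMeasurableAtFilter _ _) hc.continuousAt
  obtain ⟨δ, hδ, hGδ⟩ : ∃ δ, 0 < δ ∧ G δ ≠ 0 := by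
    by_contra! h
    have h1 : HasDerivWithinAt G 0 (Ici 0) 0 := by
      refine (hasDerivWithinAt_const (0:ℝ) (Ici 0) (0:ℂ)).congr (fun x hx => ?_) (by simp [G])
      rcases (mem_Ici.1 hx).eq_or_lt with rfl | hx
      · simp [G]
      · exact h x hx
    have := (uniqueDiffWithinAt_Ici (0:ℝ)).eq_deriv _ (hG 0).hasDerivWithinAt h1
    rw [h0] at this
    exact one_ne_zero this
  have hshift : ∀ t, 0 ≤ t → c t * G δ = G (t + δ) - G t := by
    intro t ht
    simp only [G]
    rw [intervalIntegral.integral_interval_sub_left (hc.intervalIntegrable _ _)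
      (hc.intervalIntegrable _ _), ← intervalIntegral.integral_const_mul]
    have := intervalIntegral.integral_comp_add_left (a := 0) (b := δ) c t
    rw [add_zero] at this
    rw [← this]
    refine intervalIntegral.integral_congr fun u hu => ?_
    rw [uIcc_of_le hδ.le] at hu
    exact (hadd t u ht hu.1).symm
  let z : ℂ := (c δ - 1) / G δ
  have hderiv : ∀ t, 0 ≤ t → HasDerivWithinAt c (z * c t) (Ici t) t := by
    intro t ht
    have h1 : HasDerivAt (fun t => (G (t + δ) - G t) / G δ) ((c (t + δ) - c t) / G δ) t :=
      (((hG (t + δ)).comp_add_const t δ).sub (hG t)).div_const _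
    have h2 : HasDerivWithinAt c ((c (t + δ) - c t) / G δ) (Ici t) t :=
      h1.hasDerivWithinAt.congr
        (fun x hx => by rw [eq_div_iff hGδ, hshift x (ht.trans hx)])
        (by rw [eq_div_iff hGδ, hshift t ht])
    convert h2 using 1
    rw [hadd t δ ht hδ.le]
    simp only [z]
    ring
  refine ⟨z, fun t ht => ?_⟩
  have hexp : ∀ x : ℝ, HasDerivAt (fun x : ℝ => Complex.exp (-(x * z)))
      (Complex.exp (-(x * z)) * -z) x := by
    intro x
    have : HasDerivAt (fun x : ℝ => -((x : ℂ) * z)) (-(1 * z)) x :=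
      (((hasDerivAt_id x).ofReal_comp).mul_const z).neg
    simpa using this.cexp
  have := constant_of_has_deriv_right_zero (f := fun x : ℝ => c x * Complex.exp (-(x * z)))
    (a := 0) (b := t) (by fun_prop) (fun x hx => by
      refine ((hderiv x hx.1).mul (hexp x).hasDerivWithinAt).congr_deriv ?_
      ring) t (right_mem_Icc.2 ht)
  simp only [h0, Complex.ofReal_zero, zero_mul, neg_zero, Complex.exp_zero, mul_one,
    Complex.exp_neg] at this
  field_simp at this
  exact this

lemma exists_eq_exp_of_pow_div {c : ℝ → ℂ} (hc : Continuous c) (h0 : c 0 = 1)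
    (hpow : ∀ K : ℕ, 2 ≤ K → ∀ t, c (t / K) ^ K = c t) :
    ∃ z : ℂ, ∀ t, 0 ≤ t → c t = Complex.exp (t * z) := by
  have hmul : ∀ (m : ℕ) t, c (m * t) = c t ^ m := by
    intro m t
    rcases m with _ | _ | m
    · simp [h0]
    · simp
    · rw [← hpow (m + 1 + 1) (by lia), mul_div_cancel_left₀ _ (by positivity)]
  refine exists_eq_exp_of_add_eq_mul hc h0 fun s t hs ht => ?_
  have hlim : ∀ a : ℝ, 0 ≤ a → Tendsto (fun n : ℕ => (⌊a * n⌋₊ : ℝ) / n) atTop (nhds a) :=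
    fun a ha => (tendsto_nat_floor_mul_div_atTop ha).comp tendsto_natCast_atTop_atTop
  refine tendsto_nhds_unique ((hc.tendsto _).comp ((hlim s hs).add (hlim t ht))) ?_
  refine (((hc.tendsto _).comp (hlim s hs)).mul ((hc.tendsto _).comp (hlim t ht))).congr fun n => ?_
  simp only [Function.comp_apply, div_eq_mul_inv, ← add_mul]
  rw [← Nat.cast_add, hmul, hmul, hmul, pow_add]

lemma unif01_eq_restrict_Ioo : unif01 = volume.restrict (Ioo (0:ℝ) 1) :=
  Measure.restrict_congr_set Ioo_ae_eq_Icc.symm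

lemma ae_unif01_mem_Ioo : ∀ᵐ p ∂unif01, p ∈ Ioo (0:ℝ) 1 := by
  rw [unif01_eq_restrict_Ioo]
  exact ae_restrict_mem measurableSet_Ioo

lemma map_unif01_apply {f : ℝ → ℝ} (hf : AEMeasurable f unif01) {s : Set ℝ}
    (hs : MeasurableSet s) :
    Measure.map f unif01 s = volume (f ⁻¹' s ∩ Ioo 0 1) := by
  rw [Measure.map_apply_of_aemeasurable hf hs, unif01_eq_restrict_Ioo,
    Measure.restrict_apply' measurableSet_Ioo]

lemma map_unif01_Iic_of_strictMonoOn {f : ℝ → ℝ} (hf : AEMeasurable f unif01)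
    (hm : StrictMonoOn f (Ioo 0 1)) {p : ℝ} (hp : p ∈ Ioo (0:ℝ) 1) :
    Measure.map f unif01 (Iic (f p)) = ENNReal.ofReal p := by
  have : f ⁻¹' Iic (f p) ∩ Ioo 0 1 = Ioc 0 p := by
    ext q
    constructor
    · rintro ⟨h, hq⟩
      exact ⟨hq.1, (hm.le_iff_le hq hp).1 h⟩
    · intro hq
      have hq' : q ∈ Ioo (0:ℝ) 1 := ⟨hq.1, hq.2.trans_lt hp.2⟩
      exact ⟨(hm.le_iff_le hq' hp).2 hq.2, hq'⟩
  rw [map_unif01_apply hf measurableSet_Iic, this, Real.volume_Ioc, sub_zero]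

lemma map_unif01_Iic_of_strictAntiOn {f : ℝ → ℝ} (hf : AEMeasurable f unif01)
    (hm : StrictAntiOn f (Ioo 0 1)) {p : ℝ} (hp : p ∈ Ioo (0:ℝ) 1) :
    Measure.map f unif01 (Iic (f p)) = ENNReal.ofReal (1 - p) := by
  have : f ⁻¹' Iic (f p) ∩ Ioo 0 1 = Ico p 1 := by
    ext q
    constructor
    · rintro ⟨h, hq⟩
      exact ⟨(hm.le_iff_ge hq hp).1 h, hq.2⟩
    · intro hq
      have hq' : q ∈ Ioo (0:ℝ) 1 := ⟨hp.1.trans_le hq.1, hq.2⟩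
      exact ⟨(hm.le_iff_ge hq' hp).2 hq.1, hq'⟩
  rw [map_unif01_apply hf measurableSet_Iic, this, Real.volume_Ico]

lemma map_unif01_singleton_of_injOn {f : ℝ → ℝ} (hf : AEMeasurable f unif01)
    (hi : InjOn f (Ioo 0 1)) (y : ℝ) : Measure.map f unif01 {y} = 0 := by
  rw [map_unif01_apply hf (measurableSet_singleton y)]
  refine Set.Subsingleton.measure_zero (fun a ha b hb => hi ha.2 hb.2 ?_) _
  exact (mem_singleton_iff.1 ha.1).trans (mem_singleton_iff.1 hb.1).symm

/-- The quantile function of the standard Cauchy distribution. -/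
noncomputable def cauchyQuantile (p : ℝ) : ℝ := Real.tan (π * (p - 1 / 2))

lemma cauchyQuantile_arctan (x : ℝ) : cauchyQuantile (arctan x / π + 1 / 2) = x := by
  have := Real.pi_pos.ne'
  rw [cauchyQuantile, add_sub_cancel_right, mul_div_cancel₀ _ this, tan_arctan]

lemma arctan_div_pi_add_half_mem (x : ℝ) : arctan x / π + 1 / 2 ∈ Ioo (0:ℝ) 1 := by
  have h1 := neg_pi_div_two_lt_arctan x
  have h2 := arctan_lt_pi_div_two x
  have h3 : -(1 / 2) < arctan x / π := by rw [lt_div_iff₀ Real.pi_pos]; linarith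
  have h4 : arctan x / π < 1 / 2 := by rw [div_lt_iff₀ Real.pi_pos]; linarith
  constructor <;> linarith

lemma pi_mul_sub_half_mem {p : ℝ} (hp : p ∈ Ioo (0:ℝ) 1) :
    π * (p - 1 / 2) ∈ Ioo (-(π / 2)) (π / 2) := by
  have := Real.pi_pos
  constructor <;> nlinarith [hp.1, hp.2]

lemma strictMonoOn_cauchyQuantile : StrictMonoOn cauchyQuantile (Ioo 0 1) :=
  fun _ hp _ hq h => strictMonoOn_tan (pi_mul_sub_half_mem hp) (pi_mul_sub_half_mem hq)
    (mul_lt_mul_of_pos_left (sub_lt_sub_right h _) Real.pi_pos)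

lemma measurable_cauchyQuantile : Measurable cauchyQuantile := by
  unfold cauchyQuantile
  simp_rw [Real.tan_eq_sin_div_cos]
  fun_prop

lemma integral_comp_cauchyQuantile (F : ℝ → ℂ) :
    ∫ p, F (cauchyQuantile p) ∂unif01 = ∫ x, F x * ((π * (1 + x ^ 2))⁻¹ : ℝ) := by
  have hpi := Real.pi_pos
  have himg : (fun x => arctan x / π + 1 / 2) '' univ = Ioo (0:ℝ) 1 := by
    rw [image_univ]
    ext p
    refine ⟨?_, fun hp => ⟨cauchyQuantile p, ?_⟩⟩
    · rintro ⟨x, rfl⟩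
      exact arctan_div_pi_add_half_mem x
    · have := pi_mul_sub_half_mem hp
      simp only [cauchyQuantile]
      rw [arctan_tan this.1 this.2, mul_div_cancel_left₀ _ hpi.ne']
      ring
  have hinj : InjOn (fun x => arctan x / π + 1 / 2) univ := fun x _ y _ h => by
    rw [← cauchyQuantile_arctan x, ← cauchyQuantile_arctan y]
    exact congrArg _ h
  rw [unif01_eq_restrict_Ioo, ← himg, integral_image_eq_integral_abs_deriv_smul
    MeasurableSet.univ (f' := fun x => 1 / (1 + x ^ 2) / π)
    (fun x _ => (((hasDerivAt_arctan x).div_const π).add_const _).hasDerivWithinAt) hinj,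
    setIntegral_univ]
  refine integral_congr_ae (ae_of_all _ fun x => ?_)
  have h : |1 / (1 + x ^ 2) / π| = (π * (1 + x ^ 2))⁻¹ := by
    rw [abs_of_pos (by positivity)]
    field_simp
  simp only [h, cauchyQuantile_arctan, Complex.real_smul]
  ring

lemma charFun_map_affine_cauchyQuantile (a b t : ℝ) :
    charFun (Measure.map (fun p => a * cauchyQuantile p + b) unif01) t =
      Complex.exp (t * b * Complex.I) * Complex.exp (-|a * t| : ℝ) := by
  have hm := measurable_cauchyQuantile
  rw [charFun_apply_real, integral_map (by fun_prop) (by fun_prop),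
    ← integral_exp_mul_I_mul_cauchy,
    ← integral_comp_cauchyQuantile (fun x => Complex.exp ((a * t : ℝ) * x * Complex.I)),
    ← integral_const_mul]
  refine integral_congr_ae (ae_of_all _ fun p => ?_)
  simp only [← Complex.exp_add]
  congr 1
  push_cast
  ring

lemma charFun_map_mean {ν : Measure ℝ} [IsProbabilityMeasure ν] {φ : ℝ → ℝ}
    (hφ : AEMeasurable φ ν) (K : ℕ) (t : ℝ) :
    charFun (Measure.map (fun p : Fin K → ℝ => (∑ i, φ (p i)) / (K : ℝ))
      (Measure.pi fun _ : Fin K => ν)) t = charFun (Measure.map φ ν) (t / K) ^ K := by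
  have hm : ∀ i : Fin K, AEMeasurable (fun p : Fin K → ℝ => φ (p i))
      (Measure.pi fun _ : Fin K => ν) := fun i =>
    hφ.comp_quasiMeasurePreserving (measurePreserving_eval _ i).quasiMeasurePreserving
  have hs : AEMeasurable (fun p : Fin K → ℝ => (∑ i, φ (p i)) / (K : ℝ))
      (Measure.pi fun _ : Fin K => ν) :=
    (Finset.aemeasurable_fun_sum _ fun i _ => hm i).div_const _
  rw [charFun_apply_real, charFun_apply_real, integral_map hs (by fun_prop),
    integral_map hφ (by fun_prop)]
  have := integral_fintype_prod_eq_pow (ι := Fin K) (μ := ν)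
    (fun x => Complex.exp ((t / K : ℝ) * φ x * Complex.I))
  rw [Fintype.card_fin] at this
  rw [← this]
  refine integral_congr_ae (ae_of_all _ fun p => ?_)
  simp only [← Complex.exp_sum]
  congr 1
  push_cast
  rw [← Finset.sum_mul, ← Finset.mul_sum]
  ring

lemma map_mean_eq_of_eq_affine_cauchyQuantile {φ : ℝ → ℝ} {a b : ℝ}
    (h : ∀ p ∈ Ioo (0:ℝ) 1, φ p = a * cauchyQuantile p + b) {K : ℕ} (hK : K ≠ 0) :
    Measure.map (fun p : Fin K → ℝ => (∑ i, φ (p i)) / (K : ℝ))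
      (Measure.pi fun _ : Fin K => unif01) = Measure.map φ unif01 := by
  have hae : φ =ᵐ[unif01] fun p => a * cauchyQuantile p + b := by
    filter_upwards [ae_unif01_mem_Ioo] with p hp using h p hp
  have hmT := measurable_cauchyQuantile
  have hφ : AEMeasurable φ unif01 := ⟨_, by fun_prop, hae⟩
  have := Measure.isProbabilityMeasure_map hφ
  refine Measure.ext_of_charFun (funext fun t => ?_)
  have hK' : (K : ℂ) ≠ 0 := by exact_mod_cast hK
  have hK'' : (K : ℝ) ≠ 0 := by exact_mod_cast hK
  rw [charFun_map_mean hφ, Measure.map_congr hae, charFun_map_affine_cauchyQuantile,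
    charFun_map_affine_cauchyQuantile, ← Complex.exp_add, ← Complex.exp_add, ← Complex.exp_nat_mul,
    mul_div_assoc', abs_div, Nat.abs_cast]
  congr 1
  push_cast
  field_simp

lemma exists_map_eq_affine_cauchyQuantile {φ : ℝ → ℝ} (hφ : AEMeasurable φ unif01)
    (h : ∀ K : ℕ, 2 ≤ K →
      Measure.map (fun p : Fin K → ℝ => (∑ i, φ (p i)) / (K : ℝ))
        (Measure.pi fun _ : Fin K => unif01) = Measure.map φ unif01) :
    ∃ a b : ℝ, 0 ≤ a ∧
      Measure.map φ unif01 = Measure.map (fun p => a * cauchyQuantile p + b) unif01 := by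
  have := Measure.isProbabilityMeasure_map hφ
  obtain ⟨z, hz⟩ := exists_eq_exp_of_pow_div (c := charFun (Measure.map φ unif01))
    continuous_charFun (by simp)
    (fun K hK t => by rw [← charFun_map_mean hφ, h K hK])
  have hre : z.re ≤ 0 := by
    have h1 := norm_charFun_le_one (μ := Measure.map φ unif01) (1 : ℝ)
    rw [hz 1 zero_le_one, Complex.norm_exp] at h1
    simpa using h1
  have hnonneg : ∀ t : ℝ, 0 ≤ t → charFun (Measure.map φ unif01) t =
      charFun (Measure.map (fun p => -z.re * cauchyQuantile p + z.im) unif01) t := by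
    intro t ht
    rw [hz t ht, charFun_map_affine_cauchyQuantile, ← Complex.exp_add,
      abs_of_nonneg (mul_nonneg (neg_nonneg.2 hre) ht)]
    congr 1
    conv_lhs => rw [← Complex.re_add_im z]
    push_cast
    ring
  refine ⟨-z.re, z.im, neg_nonneg.2 hre, ?_⟩
  have hmT := measurable_cauchyQuantile
  have := Measure.isProbabilityMeasure_map (μ := unif01)
    (f := fun p => -z.re * cauchyQuantile p + z.im) (by fun_prop)
  refine Measure.ext_of_charFun (funext fun t => ?_)
  rcases le_total 0 t with ht | ht
  · exact hnonneg t ht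
  · rw [← neg_neg t, charFun_neg, hnonneg (-t) (neg_nonneg.2 ht), ← charFun_neg]

lemma cauchyQuantile_one_sub (p : ℝ) : cauchyQuantile (1 - p) = -cauchyQuantile p := by
  rw [cauchyQuantile, cauchyQuantile, ← Real.tan_neg]
  congr 1
  ring

lemma eq_affine_cauchyQuantile_of_map_Iic {ν : Measure ℝ} {a b : ℝ} (ha : 0 < a)
    (hν : ν = Measure.map (fun p => a * cauchyQuantile p + b) unif01) {p : ℝ}
    (hp : p ∈ Ioo (0:ℝ) 1) {y : ℝ} (hy : ν (Iic y) = ENNReal.ofReal p) :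
    y = a * cauchyQuantile p + b := by
  have hmT := measurable_cauchyQuantile
  let q := arctan ((y - b) / a) / π + 1 / 2
  have hq : q ∈ Ioo (0:ℝ) 1 := arctan_div_pi_add_half_mem _
  have hyq : y = a * cauchyQuantile q + b := by
    simp only [q]
    rw [cauchyQuantile_arctan, mul_div_cancel₀ _ ha.ne', sub_add_cancel]
  have hmono : StrictMonoOn (fun p => a * cauchyQuantile p + b) (Ioo 0 1) := fun u hu v hv huv =>
    add_lt_add_left (mul_lt_mul_of_pos_left (strictMonoOn_cauchyQuantile hu hv huv) ha) b
  have h1 := map_unif01_Iic_of_strictMonoOn (by fun_prop) hmono hq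
  rw [← hyq, ← hν, hy, ENNReal.ofReal_eq_ofReal_iff hp.1.le hq.1.le] at h1
  rw [h1]
  exact hyq

/-- a generalized mean `M_{φ,K}` is IC-balanced for all `K ≥ 2` (i.e. the
average `(1/K)Σ φ(V_i)` of independent uniform transforms has the same distribution as
`φ(U)` for a single uniform `U`) if and only if `φ` is an affine transform (with nonzero
slope) of the standard Cauchy quantile function `tan(π(p - 1/2))`. -/
theorem icBalanced_generalized_mean_iff_cauchy
    (φ : ℝ → ℝ) (hcont : ContinuousOn φ (Set.Ioo (0:ℝ) 1))
    (hmono : StrictMonoOn φ (Set.Ioo (0:ℝ) 1) ∨ StrictAntiOn φ (Set.Ioo (0:ℝ) 1)) :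
    (∀ K : ℕ, 2 ≤ K →
      MeasureTheory.Measure.map (fun p : Fin K → ℝ => (∑ i, φ (p i)) / (K : ℝ))
          (MeasureTheory.Measure.pi fun _ : Fin K => unif01)
        = MeasureTheory.Measure.map φ unif01) ↔
    (∃ a b : ℝ, a ≠ 0 ∧ ∀ p ∈ Set.Ioo (0:ℝ) 1,
      φ p = a * Real.tan (π * (p - 1/2)) + b) := by
  have hφ : AEMeasurable φ unif01 := by
    rw [unif01_eq_restrict_Ioo]
    exact hcont.aemeasurable measurableSet_Ioo
  constructor
  · intro h
    obtain ⟨a, b, ha, hab⟩ := exists_map_eq_affine_cauchyQuantile hφ h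
    have ha' : 0 < a := by
      refine ha.lt_of_ne fun h0 => ?_
      have hinj : InjOn φ (Ioo 0 1) := hmono.elim (·.injOn) (·.injOn)
      have h1 := map_unif01_singleton_of_injOn hφ hinj b
      rw [hab, ← h0] at h1
      simp at h1
    rcases hmono with hm | hm
    · exact ⟨a, b, ha'.ne', fun p hp => eq_affine_cauchyQuantile_of_map_Iic ha' hab hp
        (map_unif01_Iic_of_strictMonoOn hφ hm hp)⟩
    · refine ⟨-a, b, neg_ne_zero.2 ha'.ne', fun p hp => ?_⟩
      have h1 := eq_affine_cauchyQuantile_of_map_Iic ha' hab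
        ⟨sub_pos.2 hp.2, sub_lt_self 1 hp.1⟩ (map_unif01_Iic_of_strictAntiOn hφ hm hp)
      rw [h1, cauchyQuantile_one_sub, cauchyQuantile, mul_neg, neg_mul]
  · rintro ⟨a, b, -, h⟩ K hK
    exact map_mean_eq_of_eq_affine_cauchyQuantile h (by lia)
end
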